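/- arXiv:1805.06955 — 2 statements merged into one kernel-verified Lean document; each statement's English description precedes it below -/
import Mathlib

section
/- Let 𝒪 ⊂ ℝ^d be a bounded domain, let p ∈ [1,2], and suppose Assumptions A–E hold. If u is a viscosity subsolution and v a viscosity supersolution of equation (E) with u(x) ≤ v(x) for all x ∉ 𝒪, then u(x) ≤ v(x) for all x ∈ 𝒪. -/
open MeasureTheory Set Metric Filter
open scoped ENNReal NNReal

noncomputable section

abbrev Euc (d : ℕ) := EuclideanSpace ℝ (Fin d)

variable {d : ℕ} {A B : Type*}

/-- `μ ∈ 𝕃_p(ℝ^d)`: a positive Borel measure on `ℝ^d ∖ {0}` (modeled as a measure on `ℝ^d`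
vanishing on `{0}`) with `N_p(μ) = ∫ min(1,|z|^p) dμ < ∞`. -/
def IsLevyLp (p : ℝ) (μ : Measure (Euc d)) : Prop :=
  μ {0} = 0 ∧ ∫⁻ z, ENNReal.ofReal (min 1 (‖z‖ ^ p)) ∂μ < ⊤

/-- `μ ∈ 𝕃_p(Ω)`: member of `𝕃_p(ℝ^d)` giving no mass to the complement of `Ω`. -/
def IsLevyLpOn (p : ℝ) (Ω : Set (Euc d)) (μ : Measure (Euc d)) : Prop :=
  IsLevyLp p μ ∧ μ Ωᶜ = 0

/-- `μ ∈ M_p(ℝ^d)`: Lévy measure with finite `p`-moment. -/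
def IsMp (p : ℝ) (μ : Measure (Euc d)) : Prop :=
  IsLevyLp p μ ∧ ∫⁻ z, ENNReal.ofReal (‖z‖ ^ p) ∂μ < ⊤

/-- Admissible transport plans between `μ₁` and `μ₂`: positive Borel measures on `ℝ^d × ℝ^d`
with no mass at `(0,0)` whose marginals, restricted to `ℝ^d ∖ {0}`, are `μ₁` and `μ₂`. -/
def AdmPlan (μ₁ μ₂ : Measure (Euc d)) : Set (Measure (Euc d × Euc d)) :=
  {γ | γ {((0 : Euc d), (0 : Euc d))} = 0 ∧
       (γ.map Prod.fst).restrict {(0 : Euc d)}ᶜ = μ₁ ∧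
       (γ.map Prod.snd).restrict {(0 : Euc d)}ᶜ = μ₂}

/-- The transport cost functional `J_p(γ) = ∫ |x-y|^p dγ`. -/
def Jp (p : ℝ) (γ : Measure (Euc d × Euc d)) : ℝ≥0∞ :=
  ∫⁻ q, ENNReal.ofReal (‖q.1 - q.2‖ ^ p) ∂γ

/-- `d_{𝕃_p}(μ,ν)^p` as an extended nonnegative real. -/
def dLpPow (p : ℝ) (μ ν : Measure (Euc d)) : ℝ≥0∞ :=
  ⨅ γ ∈ AdmPlan μ ν, Jp p γ

/-- The transport distance `d_{𝕃_p}`. -/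
def dLp (p : ℝ) (μ ν : Measure (Euc d)) : ℝ :=
  (dLpPow p μ ν).toReal ^ (1 / p)

/-- Total variation distance `|μ - ν|(X)` between two positive measures. -/
def dTV {X : Type*} [MeasurableSpace X] (μ ν : Measure X) : ℝ≥0∞ :=
  (⨆ (s : Set X) (_ : MeasurableSet s), μ s - ν s) +
  (⨆ (s : Set X) (_ : MeasurableSet s), ν s - μ s)

/-- A modulus of continuity. -/
def IsModulus (θ : ℝ → ℝ) : Prop :=
  (∀ r, 0 ≤ θ r) ∧ Monotone θ ∧ Tendsto θ (nhdsWithin 0 (Ioi 0)) (nhds 0)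

/-- Bounded uniformly continuous functions on `ℝ^d`. -/
def IsBUC (u : Euc d → ℝ) : Prop :=
  (∃ M, ∀ x, |u x| ≤ M) ∧ UniformContinuous u

/-- The Lévy operator `L_μ(φ,x) = ∫ [φ(x+z) - φ(x) - χ_{B₁}(z) Dφ(x)·z] dμ(z)`. -/
def Lop (μ : Measure (Euc d)) (φ : Euc d → ℝ) (x : Euc d) : ℝ :=
  ∫ z, (φ (x + z) - φ x -
    (ball (0 : Euc d) 1).indicator (fun w => fderiv ℝ φ x w) z) ∂μ

/-- The operator `I(φ,x) = sup_α inf_β { -L^{αβ}(φ,x) + c_{αβ}(x) φ(x) + f_{αβ}(x) }`. -/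
def Iop (μf : Euc d → A → B → Measure (Euc d)) (c f : A → B → Euc d → ℝ)
    (φ : Euc d → ℝ) (x : Euc d) : ℝ :=
  ⨆ α : A, ⨅ β : B, (-(Lop (μf x α β) φ x) + c α β x * φ x + f α β x)

/-- Viscosity subsolution of `J(u,x) = 0` in `O`. -/
def IsSubsolution (O : Set (Euc d)) (J : (Euc d → ℝ) → Euc d → ℝ) (u : Euc d → ℝ) : Prop :=
  ∀ φ : Euc d → ℝ, ContDiff ℝ 2 φ → (∃ M, ∀ x, |φ x| ≤ M) →
    ∀ x ∈ O, (∀ y, u y - φ y ≤ u x - φ x) → φ x = u x → J φ x ≤ 0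

/-- Viscosity supersolution of `J(u,x) = 0` in `O`. -/
def IsSupersolution (O : Set (Euc d)) (J : (Euc d → ℝ) → Euc d → ℝ) (u : Euc d → ℝ) : Prop :=
  ∀ φ : Euc d → ℝ, ContDiff ℝ 2 φ → (∃ M, ∀ x, |φ x| ≤ M) →
    ∀ x ∈ O, (∀ y, u x - φ x ≤ u y - φ y) → φ x = u x → 0 ≤ J φ x

/-- Assumption A, stated for a family `νhat` (the parts of the Lévy measures near the origin):
Lipschitz continuity in the transport metric `d_{𝕃_p}`. -/
def AssumptionA (O : Set (Euc d)) (p : ℝ) (νhat : Euc d → A → B → Measure (Euc d)) : Prop :=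
  ∃ C : ℝ, 0 ≤ C ∧ ∀ x ∈ O, ∀ y ∈ O, ∀ (α : A) (β : B),
    dLp p (νhat x α β) (νhat y α β) ≤ C * ‖x - y‖

/-- Assumption A1: `s`-Hölder continuity in the transport metric `d_{𝕃_p}`. -/
def AssumptionA1 (O : Set (Euc d)) (p s : ℝ) (νhat : Euc d → A → B → Measure (Euc d)) : Prop :=
  ∃ C : ℝ, 0 < C ∧ ∀ x ∈ O, ∀ y ∈ O, ∀ (α : A) (β : B),
    dLp p (νhat x α β) (νhat y α β) ≤ C * ‖x - y‖ ^ s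

/-- Assumption B: continuity in total variation of the tails. -/
def AssumptionB (O : Set (Euc d)) (νcheck : Euc d → A → B → Measure (Euc d)) : Prop :=
  ∃ θ : ℝ → ℝ, IsModulus θ ∧ ∀ x ∈ O, ∀ y ∈ O, ∀ (α : A) (β : B),
    dTV (νcheck x α β) (νcheck y α β) ≤ ENNReal.ofReal (θ ‖x - y‖)

/-- Assumption C: equicontinuity and uniform boundedness of `f_{αβ}`. -/
def AssumptionC (O : Set (Euc d)) (f : A → B → Euc d → ℝ) : Prop :=
  ∃ θ : ℝ → ℝ, IsModulus θ ∧ ∃ C : ℝ, 0 ≤ C ∧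
    (∀ x ∈ O, ∀ y ∈ O, ∀ (α : A) (β : B), |f α β x - f α β y| ≤ θ ‖x - y‖) ∧
    (∀ x ∈ O, ∀ (α : A) (β : B), |f α β x| ≤ C)

/-- Assumption D: `0 < λ ≤ c_{αβ} ≤ λ₁` and equicontinuity of `c_{αβ}`. -/
def AssumptionD (O : Set (Euc d)) (c : A → B → Euc d → ℝ) : Prop :=
  ∃ lam lam1 : ℝ, 0 < lam ∧ lam ≤ lam1 ∧
    (∀ x ∈ O, ∀ (α : A) (β : B), lam ≤ c α β x ∧ c α β x ≤ lam1) ∧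
    ∃ θ : ℝ → ℝ, IsModulus θ ∧
      ∀ x ∈ O, ∀ y ∈ O, ∀ (α : A) (β : B), |c α β x - c α β y| ≤ θ ‖x - y‖

/-- Assumption E: uniform integrability of the Lévy measures. -/
def AssumptionE (O : Set (Euc d)) (p : ℝ) (μf : Euc d → A → B → Measure (Euc d)) : Prop :=
  (∃ θ : ℝ → ℝ, IsModulus θ ∧ ∀ r : ℝ, 0 < r → ∀ x ∈ O, ∀ (α : A) (β : B),
      ∫⁻ z in ball (0 : Euc d) r, ENNReal.ofReal (‖z‖ ^ p) ∂(μf x α β) ≤ ENNReal.ofReal (θ r)) ∧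
  (∃ Λ : ℝ, 0 ≤ Λ ∧ ∀ x ∈ O, ∀ (α : A) (β : B),
      ∫⁻ z, ENNReal.ofReal (min 1 (‖z‖ ^ p)) ∂(μf x α β) ≤ ENNReal.ofReal Λ)

/-- The smooth approximation `ψ_κ(x) = (κ + |x|²)^{p/2} - κ^{p/2}` of `|x|^p`. -/
def psiK (p κ : ℝ) (x : Euc d) : ℝ := (κ + ‖x‖ ^ 2) ^ (p / 2) - κ ^ (p / 2)

/-- `u` is pointwise-`C^{1,1}` at `x₀`. -/
def PointwiseC11 (u : Euc d → ℝ) (x₀ : Euc d) : Prop :=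
  DifferentiableAt ℝ u x₀ ∧ ∃ C : ℝ, 0 < C ∧ ∀ᶠ x in nhds x₀,
    |u x - u x₀ - fderiv ℝ u x₀ (x - x₀)| ≤ C * ‖x - x₀‖ ^ 2

/-- Sup-convolution `u^δ`. -/
def supConv (δ : ℝ) (u : Euc d → ℝ) (x : Euc d) : ℝ :=
  ⨆ y : Euc d, (u y - ‖x - y‖ ^ 2 / δ)

/-- Inf-convolution `v_δ`. -/
def infConv (δ : ℝ) (v : Euc d → ℝ) (x : Euc d) : ℝ :=
  ⨅ y : Euc d, (v y + ‖x - y‖ ^ 2 / δ)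

/-- `(φ,ψ) ∈ Adm^p`, the admissible pairs for the dual problem. -/
def AdmPair (p : ℝ) (μ₁ μ₂ : Measure (Euc d)) (φ ψ : Euc d → ℝ) : Prop :=
  Integrable φ μ₁ ∧ Integrable ψ μ₂ ∧
  UpperSemicontinuous φ ∧ UpperSemicontinuous ψ ∧
  φ 0 = 0 ∧ ψ 0 = 0 ∧ ∀ x y : Euc d, φ x + ψ y ≤ ‖x - y‖ ^ p

lemma sq_rpow_half {s : ℝ} (hs : 0 ≤ s) (p : ℝ) : (s ^ 2) ^ (p / 2) = s ^ p := by
  rw [← Real.rpow_natCast, ← Real.rpow_mul hs]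
  congr 1
  push_cast
  ring

lemma rpow_le_tangent {t r q : ℝ} (ht : 0 < t) (hr : 0 ≤ r) (hq0 : 0 ≤ q) (hq1 : q ≤ 1) :
    r ^ q ≤ t ^ q + q * t ^ (q - 1) * (r - t) := by
  have h1 : -1 ≤ (r - t) / t := by
    rw [le_div_iff₀ ht]; linarith
  have h := rpow_one_add_le_one_add_mul_self h1 hq0 hq1
  have h2 : 1 + (r - t) / t = r / t := by field_simp; ring
  rw [h2, Real.div_rpow hr ht.le, div_le_iff₀ (Real.rpow_pos_of_pos ht q)] at h
  rw [Real.rpow_sub_one ht.ne']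
  calc r ^ q ≤ _ := h
    _ = _ := by ring

lemma psiK_add_le {p κ : ℝ} (hp1 : 1 ≤ p) (hp2 : p ≤ 2) (hκ : 0 < κ) (a h : Euc d) :
    psiK p κ (a + h) - psiK p κ a ≤
      p * (κ + ‖a‖ ^ 2) ^ (p / 2 - 1) * inner ℝ a h + 6 * ‖h‖ ^ p := by
  unfold psiK
  obtain ⟨s, hs, hst⟩ : ∃ s : ℝ, 0 < s ∧ s ^ 2 = κ + ‖a‖ ^ 2 :=
    ⟨√(κ + ‖a‖ ^ 2), by positivity, Real.sq_sqrt (by positivity)⟩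
  have ht : 0 < κ + ‖a‖ ^ 2 := by positivity
  have hnorm : ‖a + h‖ ^ 2 = ‖a‖ ^ 2 + 2 * inner ℝ a h + ‖h‖ ^ 2 := norm_add_sq_real a h
  have hpow : (κ + ‖a‖ ^ 2) ^ (p / 2) = s ^ p := by rw [← hst, sq_rpow_half hs.le]
  have hpow' : (κ + ‖a‖ ^ 2) ^ (p / 2 - 1) = s ^ (p - 2) := by
    rw [← hst, ← sq_rpow_half hs.le]; congr 1; ring
  have hsp : 0 < s ^ (p - 2) := Real.rpow_pos_of_pos hs _
  have hhp : 0 ≤ ‖h‖ ^ p := by positivity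
  rcases le_or_gt ‖h‖ s with hle | hlt
  · have key := rpow_le_tangent (q := p / 2) ht
      (by positivity : 0 ≤ κ + ‖a + h‖ ^ 2) (by linarith) (by linarith)
    have h3 : s ^ (p - 2) * ‖h‖ ^ 2 ≤ ‖h‖ ^ p := by
      rcases (norm_nonneg h).eq_or_lt with h0 | h0
      · rw [← h0]; simp; positivity
      · calc s ^ (p - 2) * ‖h‖ ^ 2 ≤ ‖h‖ ^ (p - 2) * ‖h‖ ^ 2 := by
              gcongr ?_ * _
              exact Real.rpow_le_rpow_of_nonpos h0 hle (by linarith)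
          _ = ‖h‖ ^ p := by
              rw [← Real.rpow_natCast, ← Real.rpow_add h0]; congr 1; push_cast; ring
    rw [hpow'] at *
    have h4 : κ + ‖a + h‖ ^ 2 - (κ + ‖a‖ ^ 2) = 2 * inner ℝ a h + ‖h‖ ^ 2 := by
      rw [hnorm]; ring
    rw [h4] at key
    nlinarith
  · have h0 : 0 < ‖h‖ := hs.trans hlt
    have hak : ‖a‖ ≤ s := by
      apply le_of_sq_le_sq _ hs.le
      rw [hst]; linarith
    have hin : -(‖a‖ * ‖h‖) ≤ inner ℝ a h := by
      have := abs_le.1 (abs_real_inner_le_norm a h); exact this.1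
    have hin2 : inner ℝ a h ≤ ‖a‖ * ‖h‖ := real_inner_le_norm a h
    have h1 : (κ + ‖a + h‖ ^ 2) ^ (p / 2) ≤ 4 * ‖h‖ ^ p := by
      have : κ + ‖a + h‖ ^ 2 ≤ (2 * ‖h‖) ^ 2 := by
        rw [hnorm]; nlinarith [norm_nonneg a]
      calc (κ + ‖a + h‖ ^ 2) ^ (p / 2) ≤ ((2 * ‖h‖) ^ 2) ^ (p / 2) := by gcongr; 
        _ = (2 * ‖h‖) ^ p := sq_rpow_half (by positivity) p
        _ = 2 ^ p * ‖h‖ ^ p := Real.mul_rpow (by norm_num) h0.le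
        _ ≤ 2 ^ (2 : ℝ) * ‖h‖ ^ p := by gcongr; norm_num
        _ = 4 * ‖h‖ ^ p := by norm_num
    have h2 : s ^ (p - 2) * (s * ‖h‖) ≤ ‖h‖ ^ p := by
      calc s ^ (p - 2) * (s * ‖h‖) = s ^ (p - 1) * ‖h‖ := by
            rw [← mul_assoc, ← Real.rpow_add_one hs.ne']; congr 2; ring
        _ ≤ ‖h‖ ^ (p - 1) * ‖h‖ := by gcongr
        _ = ‖h‖ ^ p := by rw [← Real.rpow_add_one h0.ne']; congr 1; ring
    rw [hpow', hpow]
    have h5 : s ^ (p - 2) * -(s * ‖h‖) ≤ s ^ (p - 2) * inner ℝ a h := by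
      gcongr
      nlinarith
    have h6 : 0 < s ^ p := Real.rpow_pos_of_pos hs _
    nlinarith

lemma hasFDerivAt_psiK {p κ : ℝ} (hκ : 0 < κ) (a : Euc d) :
    HasFDerivAt (psiK p κ) ((p * (κ + ‖a‖ ^ 2) ^ (p / 2 - 1)) • innerSL ℝ a) a := by
  have h1 : HasFDerivAt (fun x : Euc d => κ + ‖x‖ ^ 2) (2 • innerSL ℝ a) a :=
    ((hasStrictFDerivAt_norm_sq a).hasFDerivAt).const_add κ
  have h2 := (h1.rpow_const (p := p / 2) (Or.inl (by positivity))).sub_const (κ ^ (p / 2))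
  refine h2.congr_fderiv ?_
  ext z
  simp only [smul_apply, innerSL_apply_apply, smul_eq_mul, nsmul_eq_mul]
  push_cast
  ring

lemma contDiff_psiK {p κ : ℝ} (hκ : 0 < κ) : ContDiff ℝ 2 (psiK (d := d) p κ) := by
  unfold psiK
  apply ContDiff.sub _ contDiff_const
  apply ContDiff.rpow_const_of_ne
  · exact contDiff_const.add (contDiff_norm_sq ℝ)
  · intro x; positivity

lemma rpow_norm_le_psiK {p κ : ℝ} (hp : 0 ≤ p) (hκ : 0 < κ) (x : Euc d) :
    ‖x‖ ^ p ≤ psiK p κ x + κ ^ (p / 2) := by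
  unfold psiK
  rw [← sq_rpow_half (norm_nonneg x), sub_add_cancel]
  gcongr
  linarith

lemma psiK_nonneg {p κ : ℝ} (hp : 0 ≤ p) (hκ : 0 < κ) (x : Euc d) : 0 ≤ psiK p κ x := by
  unfold psiK
  rw [sub_nonneg]
  gcongr
  nlinarith [sq_nonneg ‖x‖]

lemma psiK_zero {p κ : ℝ} : psiK p κ (0 : Euc d) = 0 := by
  simp [psiK]

/-- A function touched from above at `x₀` by a `C²` function `P` admits a bounded `C²` majorant
which has the jet of `P` at `x₀` and is close to the function itself away from `x₀`. -/
lemma exists_bounded_test {p : ℝ} (hp : 1 ≤ p) {w P : Euc d → ℝ} (hw : IsBUC w)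
    (hP : ContDiff ℝ 2 P)
    (x₀ : Euc d) (hmax : ∀ z, w (x₀ + z) - w x₀ ≤ P (x₀ + z) - P x₀) {δ : ℝ} (hδ : 0 < δ)
    (hδ1 : δ ≤ 1) :
    ∃ Φ : Euc d → ℝ, ContDiff ℝ 2 Φ ∧ (∃ M, ∀ x, |Φ x| ≤ M) ∧ (∀ x, w x ≤ Φ x) ∧ Φ x₀ = w x₀ ∧
      fderiv ℝ Φ x₀ = fderiv ℝ P x₀ ∧
      (∀ z, Φ (x₀ + z) - w x₀ ≤ P (x₀ + z) - P x₀ + δ * ‖z‖ ^ p) ∧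
      (∀ z, δ ≤ ‖z‖ → Φ (x₀ + z) ≤ w (x₀ + z) + δ * min 1 (‖z‖ ^ p)) := by
  obtain ⟨M, hM⟩ := hw.1
  set η : ℝ := δ * (δ / 2) ^ p with hη
  have hηpos : 0 < η := by positivity
  obtain ⟨g₀, hg₀, hg₀w⟩ := hw.2.exists_contDiff_dist_le (half_pos hηpos)
  have hg₀' : ContDiff ℝ 2 g₀ := contDiff_infty.1 hg₀ 2
  have hg1 : ∀ x, w x ≤ g₀ x + η / 2 := fun x => by
    have := (abs_lt.1 (by simpa [Real.dist_eq] using hg₀w x)).1; linarith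
  have hg2 : ∀ x, g₀ x + η / 2 ≤ w x + η := fun x => by
    have := (abs_lt.1 (by simpa [Real.dist_eq] using hg₀w x)).2; linarith
  let b : ContDiffBump x₀ := ⟨δ / 2, δ, by positivity, by linarith⟩
  have hb : ContDiff ℝ 2 b := b.contDiff
  set Φ : Euc d → ℝ := fun x =>
    b x * (w x₀ + (P x - P x₀)) + (1 - b x) * (g₀ x + η / 2) with hΦ
  have hΦcont : ContDiff ℝ 2 Φ :=
    (hb.mul (contDiff_const.add (hP.sub contDiff_const))).add
      ((contDiff_const.sub hb).mul (hg₀'.add contDiff_const))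
  have hin : ∀ x, ‖x - x₀‖ ≤ δ / 2 → b x = 1 := fun x hx =>
    b.one_of_mem_closedBall (by simpa [dist_eq_norm] using hx)
  have hout : ∀ x, δ ≤ ‖x - x₀‖ → b x = 0 := fun x hx =>
    b.zero_of_le_dist (by simpa [dist_eq_norm] using hx)
  have hb0 : ∀ x, 0 ≤ b x := fun x => b.nonneg
  have hb1 : ∀ x, b x ≤ 1 := fun x => b.le_one
  have hwP : ∀ x, w x ≤ w x₀ + (P x - P x₀) := fun x => by
    have := hmax (x - x₀); simp at this; linarith
  have hwΦ : ∀ x, w x ≤ Φ x := fun x => by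
    have h1 := mul_le_mul_of_nonneg_left (hwP x) (hb0 x)
    have h2 := mul_le_mul_of_nonneg_left (hg1 x) (sub_nonneg.2 (hb1 x))
    simp only [hΦ]; nlinarith
  have hfar : ∀ x, δ ≤ ‖x - x₀‖ → Φ x ≤ w x + η := fun x hx => by
    simp only [hΦ, hout x hx]; linarith [hg2 x]
  have hnear : ∀ x, ‖x - x₀‖ ≤ δ / 2 → Φ x = w x₀ + (P x - P x₀) := fun x hx => by
    simp only [hΦ, hin x hx]; ring
  have hΦP : ∀ x, Φ x ≤ w x₀ + (P x - P x₀) + η := fun x => by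
    have h2 := mul_le_mul_of_nonneg_left ((hg2 x).trans (add_le_add_left (hwP x) η))
      (sub_nonneg.2 (hb1 x))
    simp only [hΦ]; nlinarith [hb0 x]
  have hηle : ∀ z : Euc d, δ / 2 ≤ ‖z‖ → η ≤ δ * ‖z‖ ^ p := fun z hz => by
    rw [hη]; gcongr
  have hη1 : η ≤ δ * 1 := by
    rw [hη]
    gcongr
    exact Real.rpow_le_one (by positivity) (by linarith) (by linarith)
  refine ⟨Φ, hΦcont, ?_, hwΦ, ?_, ?_, ?_, ?_⟩
  · obtain ⟨K, hK⟩ := (isCompact_closedBall x₀ δ).exists_bound_of_continuousOn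
      hΦcont.continuous.continuousOn
    refine ⟨max K (M + η), fun x => ?_⟩
    by_cases hx : ‖x - x₀‖ ≤ δ
    · exact (hK x (by simpa [dist_eq_norm] using hx)).trans (le_max_left _ _)
    · refine le_trans ?_ (le_max_right _ _)
      have h1 := hfar x (not_le.1 hx).le
      have h2 := hwΦ x
      have h3 := abs_le.1 (hM x)
      rw [abs_le]; constructor <;> linarith
  · rw [hnear x₀ (by simp; positivity)]; ring
  · have : Φ =ᶠ[nhds x₀] fun x => w x₀ + (P x - P x₀) := by
      filter_upwards [closedBall_mem_nhds x₀ (half_pos hδ)] with x hx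
      exact hnear x (by simpa [dist_eq_norm] using hx)
    rw [this.fderiv_eq, fderiv_const_add, fderiv_sub_const]
  · intro z
    rcases le_total ‖z‖ (δ / 2) with hz | hz
    · rw [hnear _ (by simpa using hz)]
      have : 0 ≤ δ * ‖z‖ ^ p := by positivity
      linarith
    · linarith [hΦP (x₀ + z), hηle z hz]
  · intro z hz
    have h1 := hfar (x₀ + z) (by simpa using hz)
    have h2 : η ≤ δ * min 1 (‖z‖ ^ p) := by
      rw [mul_min_of_nonneg _ _ hδ.le]
      exact le_min hη1 (hηle z (by linarith))
    linarith

/-- The integrand of the Lévy operator. -/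
def lopIntegrand (φ : Euc d → ℝ) (x z : Euc d) : ℝ :=
  φ (x + z) - φ x - (ball (0 : Euc d) 1).indicator (fun w => fderiv ℝ φ x w) z

lemma measurable_lopIntegrand {φ : Euc d → ℝ} (hφ : Continuous φ) (x : Euc d) :
    Measurable (lopIntegrand φ x) := by
  unfold lopIntegrand
  have h1 : Measurable fun z => φ (x + z) :=
    (hφ.comp (continuous_const.add continuous_id)).measurable
  exact (h1.sub_const _).sub ((fderiv ℝ φ x).continuous.measurable.indicator measurableSet_ball)

lemma lopIntegrand_zero (φ : Euc d → ℝ) (x : Euc d) : lopIntegrand φ x 0 = 0 := by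
  simp [lopIntegrand]

lemma sq_le_rpow_of_le_one {p t : ℝ} (hp0 : 0 < p) (hp2 : p ≤ 2) (ht : 0 ≤ t) (ht1 : t ≤ 1) :
    t ^ 2 ≤ t ^ p := by
  rcases ht.eq_or_lt with rfl | h
  · simp [Real.zero_rpow hp0.ne']
  · rw [← Real.rpow_natCast]
    exact Real.rpow_le_rpow_of_exponent_ge h ht1 (by exact_mod_cast hp2)

lemma exists_abs_lopIntegrand_le {p : ℝ} (hp1 : 1 ≤ p) (hp2 : p ≤ 2) {φ : Euc d → ℝ}
    (hφ : ContDiff ℝ 2 φ) (hb : ∃ M, ∀ x, |φ x| ≤ M) (x : Euc d) :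
    ∃ C, 0 ≤ C ∧ ∀ z, |lopIntegrand φ x z| ≤ C * min 1 (‖z‖ ^ p) := by
  obtain ⟨M, hM⟩ := hb
  have hD : ContDiff ℝ 1 (fderiv ℝ φ) := hφ.fderiv_right (by norm_num)
  obtain ⟨K, hK⟩ := (isCompact_closedBall x 1).exists_bound_of_continuousOn
    (hD.continuous_fderiv one_ne_zero).continuousOn
  have hK0 : 0 ≤ K := (norm_nonneg _).trans (hK x (by simp))
  have hM0 : 0 ≤ M := (abs_nonneg _).trans (hM x)
  refine ⟨max (2 * M) K, by positivity, fun z => ?_⟩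
  rcases lt_or_ge ‖z‖ 1 with hz | hz
  · have hp : ‖z‖ ^ p ≤ 1 := Real.rpow_le_one (norm_nonneg _) hz.le (by linarith)
    rw [min_eq_right hp]
    have hzb : z ∈ ball (0 : Euc d) 1 := by simpa using hz
    have hLip : ∀ y ∈ closedBall x ‖z‖, ‖fderiv ℝ φ y - fderiv ℝ φ x‖ ≤ K * ‖z‖ := by
      intro y hy
      have hy' : ‖y - x‖ ≤ ‖z‖ := by simpa [dist_eq_norm] using hy
      refine ((convex_closedBall x 1).norm_image_sub_le_of_norm_fderiv_le
        (fun w _ => hD.differentiable one_ne_zero w) hK (by simp)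
        (by simpa [dist_eq_norm] using hy'.trans hz.le)).trans ?_
      gcongr
    have h := (convex_closedBall x ‖z‖).norm_image_sub_le_of_norm_fderiv_le'
      (fun w _ => hφ.differentiable two_ne_zero w) hLip
      (mem_closedBall_self (norm_nonneg z))
      (show x + z ∈ closedBall x ‖z‖ by simp [dist_eq_norm])
    rw [add_sub_cancel_left, Real.norm_eq_abs] at h
    rw [lopIntegrand, indicator_of_mem hzb]
    calc _ ≤ K * ‖z‖ * ‖z‖ := h
      _ = K * ‖z‖ ^ 2 := by ring
      _ ≤ _ := by
        gcongr
        · exact le_max_right _ _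
        · exact sq_le_rpow_of_le_one (by linarith) hp2 (norm_nonneg _) hz.le
  · have hp : 1 ≤ ‖z‖ ^ p := Real.one_le_rpow hz (by linarith)
    rw [min_eq_left hp, mul_one, lopIntegrand, indicator_of_notMem (by simpa using hz), sub_zero]
    refine le_trans ?_ (le_max_left _ _)
    have h1 := abs_le.1 (hM (x + z))
    have h2 := abs_le.1 (hM x)
    rw [abs_le]; constructor <;> linarith

lemma measurable_norm_rpow (p : ℝ) : Measurable fun z : Euc d => ‖z‖ ^ p :=
  measurable_norm.pow_const p

lemma integrable_min_norm {p : ℝ} {μ : Measure (Euc d)} (h : IsLevyLp p μ) :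
    Integrable (fun z => min 1 (‖z‖ ^ p)) μ := by
  refine ⟨(measurable_const.min (measurable_norm_rpow p)).aestronglyMeasurable, ?_⟩
  rw [hasFiniteIntegral_iff_ofReal (Eventually.of_forall fun z => by positivity)]
  exact h.2

lemma integral_le_of_lintegral_le {α : Type*} [MeasurableSpace α] {μ : Measure α} {g : α → ℝ}
    {T : ℝ} (hT : 0 ≤ T) (hg0 : ∀ z, 0 ≤ g z) (hg : Measurable g)
    (h : ∫⁻ z, ENNReal.ofReal (g z) ∂μ ≤ ENNReal.ofReal T) : ∫ z, g z ∂μ ≤ T := by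
  rw [integral_eq_lintegral_of_nonneg_ae (Eventually.of_forall hg0) hg.aestronglyMeasurable]
  exact ENNReal.toReal_le_of_le_ofReal hT h

lemma integrable_lopIntegrand {p : ℝ} (hp1 : 1 ≤ p) (hp2 : p ≤ 2) {φ : Euc d → ℝ}
    (hφ : ContDiff ℝ 2 φ) (hb : ∃ M, ∀ x, |φ x| ≤ M) (x : Euc d) {μ : Measure (Euc d)}
    (hμ : IsLevyLp p μ) : Integrable (lopIntegrand φ x) μ := by
  obtain ⟨C, -, hC⟩ := exists_abs_lopIntegrand_le hp1 hp2 hφ hb x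
  exact ((integrable_min_norm hμ).const_mul C).mono'
    (measurable_lopIntegrand hφ.continuous x).aestronglyMeasurable (Eventually.of_forall hC)

lemma exists_abs_Lop_le {p : ℝ} (hp1 : 1 ≤ p) (hp2 : p ≤ 2) {φ : Euc d → ℝ}
    (hφ : ContDiff ℝ 2 φ) (hb : ∃ M, ∀ x, |φ x| ≤ M) (x : Euc d) {Λ : ℝ} (hΛ : 0 ≤ Λ) :
    ∃ R, ∀ μ : Measure (Euc d), IsLevyLp p μ →
      ∫⁻ z, ENNReal.ofReal (min 1 (‖z‖ ^ p)) ∂μ ≤ ENNReal.ofReal Λ → |Lop μ φ x| ≤ R := by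
  obtain ⟨C, hC0, hC⟩ := exists_abs_lopIntegrand_le hp1 hp2 hφ hb x
  refine ⟨C * Λ, fun μ hμ hμΛ => ?_⟩
  calc |Lop μ φ x| ≤ ∫ z, C * min 1 (‖z‖ ^ p) ∂μ :=
        norm_integral_le_of_norm_le (f := lopIntegrand φ x) ((integrable_min_norm hμ).const_mul C)
          (Eventually.of_forall hC)
    _ = C * ∫ z, min 1 (‖z‖ ^ p) ∂μ := integral_const_mul _ _
    _ ≤ C * Λ := by
      gcongr
      exact integral_le_of_lintegral_le hΛ (fun z => by positivity)
        (measurable_const.min (measurable_norm_rpow p)) hμΛ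

lemma measure_compl_ball_le {p : ℝ} (hp : 0 ≤ p) {μ : Measure (Euc d)} :
    μ (ball (0 : Euc d) 1)ᶜ ≤ ∫⁻ z, ENNReal.ofReal (min 1 (‖z‖ ^ p)) ∂μ := by
  calc μ (ball (0 : Euc d) 1)ᶜ = ∫⁻ z in (ball (0 : Euc d) 1)ᶜ, 1 ∂μ := by simp
    _ ≤ ∫⁻ z in (ball (0 : Euc d) 1)ᶜ, ENNReal.ofReal (min 1 (‖z‖ ^ p)) ∂μ := by
      refine setLIntegral_mono' measurableSet_ball.compl fun z hz => ?_
      have : 1 ≤ ‖z‖ := by simpa using hz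
      rw [min_eq_left (Real.one_le_rpow this hp), ENNReal.ofReal_one]
    _ ≤ _ := setLIntegral_le_lintegral _ _

lemma lintegral_ball_norm_rpow_le {p : ℝ} (hp : 0 ≤ p) {μ : Measure (Euc d)} :
    ∫⁻ z in ball (0 : Euc d) 1, ENNReal.ofReal (‖z‖ ^ p) ∂μ ≤
      ∫⁻ z, ENNReal.ofReal (min 1 (‖z‖ ^ p)) ∂μ := by
  refine le_trans (setLIntegral_mono' measurableSet_ball fun z hz => ?_)
    (setLIntegral_le_lintegral (ball (0 : Euc d) 1) _)
  have : ‖z‖ < 1 := by simpa using hz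
  rw [min_eq_right (Real.rpow_le_one (norm_nonneg _) this.le hp)]

lemma integrable_and_integral_restrict_compl_zero {F : Euc d → ℝ} (h0 : F 0 = 0)
    {m : Measure (Euc d)} (hF : Integrable F (m.restrict {0}ᶜ)) :
    Integrable F m ∧ ∫ z, F z ∂(m.restrict {0}ᶜ) = ∫ z, F z ∂m := by
  constructor
  · refine (integrableOn_iff_integrable_of_support_subset ?_).1 hF
    intro z hz hz0
    rw [mem_singleton_iff] at hz0
    subst hz0
    exact hz h0
  · refine setIntegral_eq_integral_of_forall_compl_eq_zero fun z hz => ?_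
    have : z = 0 := by simpa using hz
    rw [this, h0]

/-- Integration of a pointwise inequality against a transport plan. -/
lemma integral_sub_le_of_mem_admPlan {p k : ℝ} {μ ν : Measure (Euc d)}
    {γ : Measure (Euc d × Euc d)} (hγ : γ ∈ AdmPlan μ ν) (hJ : Jp p γ ≠ ⊤) {S : Set (Euc d)}
    (hS : MeasurableSet S) (h0S : (0 : Euc d) ∈ S) (hμ : μ Sᶜ = 0) (hν : ν Sᶜ = 0)
    {F G : Euc d → ℝ} (hFm : Measurable F) (hGm : Measurable G) (hF0 : F 0 = 0) (hG0 : G 0 = 0)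
    (hF : Integrable F μ) (hG : Integrable G ν)
    (h : ∀ x ∈ S, ∀ y ∈ S, F x - G y ≤ k * ‖x - y‖ ^ p) :
    ∫ z, F z ∂μ - ∫ z, G z ∂ν ≤ k * (Jp p γ).toReal := by
  obtain ⟨-, rfl, rfl⟩ := hγ
  obtain ⟨hF1, hF2⟩ := integrable_and_integral_restrict_compl_zero hF0 hF
  obtain ⟨hG1, hG2⟩ := integrable_and_integral_restrict_compl_zero hG0 hG
  rw [hF2, hG2, integral_map measurable_fst.aemeasurable hFm.aestronglyMeasurable,
    integral_map measurable_snd.aemeasurable hGm.aestronglyMeasurable]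
  rw [integrable_map_measure hFm.aestronglyMeasurable measurable_fst.aemeasurable] at hF1
  rw [integrable_map_measure hGm.aestronglyMeasurable measurable_snd.aemeasurable] at hG1
  have hsub : Sᶜ ⊆ {(0 : Euc d)}ᶜ := by
    intro z hz hz0
    rw [mem_singleton_iff] at hz0
    exact hz (hz0 ▸ h0S)
  rw [Measure.restrict_eq_self _ hsub] at hμ hν
  rw [Measure.map_apply measurable_fst hS.compl] at hμ
  rw [Measure.map_apply measurable_snd hS.compl] at hν
  have hc : Measurable fun q : Euc d × Euc d => ‖q.1 - q.2‖ ^ p :=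
    (measurable_fst.sub measurable_snd).norm.pow_const p
  have hci : Integrable (fun q : Euc d × Euc d => ‖q.1 - q.2‖ ^ p) γ := by
    refine ⟨hc.aestronglyMeasurable, ?_⟩
    rw [hasFiniteIntegral_iff_ofReal (Eventually.of_forall fun z => by positivity)]
    exact lt_top_iff_ne_top.2 hJ
  have e : (Jp p γ).toReal = ∫ q, ‖q.1 - q.2‖ ^ p ∂γ := by
    rw [integral_eq_lintegral_of_nonneg_ae (Eventually.of_forall fun z => by positivity)
      hc.aestronglyMeasurable]
    rfl
  rw [e, ← integral_const_mul, ← integral_sub (f := fun q : Euc d × Euc d => F q.1)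
    (g := fun q : Euc d × Euc d => G q.2) hF1 hG1]
  refine integral_mono_ae (hF1.sub hG1) (hci.const_mul k) ?_
  have h1 : ∀ᵐ q ∂γ, q.1 ∈ S := by rw [ae_iff]; exact hμ
  have h2 : ∀ᵐ q ∂γ, q.2 ∈ S := by rw [ae_iff]; exact hν
  filter_upwards [h1, h2] with q hq1 hq2 using h _ hq1 _ hq2

/-- Moving all the mass to and from the origin is an admissible plan of finite cost. -/
lemma dLpPow_ne_top {p : ℝ} {μ ν : Measure (Euc d)} (hμ0 : μ {0} = 0)
    (hν0 : ν {0} = 0) (hμ : ∫⁻ z, ENNReal.ofReal (‖z‖ ^ p) ∂μ ≠ ⊤)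
    (hν : ∫⁻ z, ENNReal.ofReal (‖z‖ ^ p) ∂ν ≠ ⊤) : dLpPow p μ ν ≠ ⊤ := by
  have m1 : Measurable fun z : Euc d => (z, (0 : Euc d)) := by fun_prop
  have m2 : Measurable fun z : Euc d => ((0 : Euc d), z) := by fun_prop
  set γ : Measure (Euc d × Euc d) := μ.map (fun z => (z, 0)) + ν.map (fun z => (0, z)) with hγ
  have hadm : γ ∈ AdmPlan μ ν := by
    refine ⟨?_, ?_, ?_⟩
    · rw [hγ, Measure.add_apply, Measure.map_apply m1 (measurableSet_singleton _),
        Measure.map_apply m2 (measurableSet_singleton _)]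
      have e1 : (fun z : Euc d => (z, (0 : Euc d))) ⁻¹' {(0, 0)} = {0} := by ext; simp
      have e2 : (fun z : Euc d => ((0 : Euc d), z)) ⁻¹' {(0, 0)} = {0} := by ext; simp
      rw [e1, e2, hμ0, hν0, add_zero]
    · ext s hs
      have hs' : MeasurableSet (s ∩ {(0 : Euc d)}ᶜ) := hs.inter (measurableSet_singleton _).compl
      rw [Measure.restrict_apply hs, Measure.map_apply measurable_fst hs', hγ, Measure.add_apply,
        Measure.map_apply m1 (measurable_fst hs'), Measure.map_apply m2 (measurable_fst hs')]
      have e1 : (fun z : Euc d => (z, (0 : Euc d))) ⁻¹' (Prod.fst ⁻¹' (s ∩ {0}ᶜ)) = s \ {0} := by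
        ext; simp
      have e2 : (fun z : Euc d => ((0 : Euc d), z)) ⁻¹' (Prod.fst ⁻¹' (s ∩ {0}ᶜ)) = ∅ := by
        ext; simp
      rw [e1, e2, measure_empty, add_zero, measure_sdiff_null hμ0]
    · ext s hs
      have hs' : MeasurableSet (s ∩ {(0 : Euc d)}ᶜ) := hs.inter (measurableSet_singleton _).compl
      rw [Measure.restrict_apply hs, Measure.map_apply measurable_snd hs', hγ, Measure.add_apply,
        Measure.map_apply m1 (measurable_snd hs'), Measure.map_apply m2 (measurable_snd hs')]
      have e1 : (fun z : Euc d => (z, (0 : Euc d))) ⁻¹' (Prod.snd ⁻¹' (s ∩ {0}ᶜ)) = ∅ := by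
        ext; simp
      have e2 : (fun z : Euc d => ((0 : Euc d), z)) ⁻¹' (Prod.snd ⁻¹' (s ∩ {0}ᶜ)) = s \ {0} := by
        ext; simp
      rw [e1, e2, measure_empty, zero_add, measure_sdiff_null hν0]
  have hcost : Jp p γ ≠ ⊤ := by
    have hc : Measurable fun q : Euc d × Euc d => ENNReal.ofReal (‖q.1 - q.2‖ ^ p) :=
      ((measurable_fst.sub measurable_snd).norm.pow_const p).ennreal_ofReal
    rw [Jp, hγ, lintegral_add_measure, lintegral_map hc m1, lintegral_map hc m2]
    simpa using ⟨hμ, hν⟩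
  exact ne_top_of_le_ne_top hcost (iInf₂_le γ hadm)

lemma lintegral_le_add_of_measure_le {α : Type*} [MeasurableSpace α] {μ ν : Measure α}
    {D : ℝ≥0∞} (h : ∀ s, MeasurableSet s → μ s ≤ ν s + D) {g : α → ℝ} (hg : Measurable g) {R : ℝ}
    (h0 : ∀ x, 0 ≤ g x) (hR : ∀ x, g x ≤ R) :
    ∫⁻ x, ENNReal.ofReal (g x) ∂μ ≤
      ∫⁻ x, ENNReal.ofReal (g x) ∂ν + ENNReal.ofReal R * D := by
  rw [lintegral_eq_lintegral_meas_lt μ (Eventually.of_forall h0) hg.aemeasurable,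
    lintegral_eq_lintegral_meas_lt ν (Eventually.of_forall h0) hg.aemeasurable]
  have e : ENNReal.ofReal R * D = ∫⁻ t in Ioi (0 : ℝ), (Ioo (0 : ℝ) R).indicator (fun _ => D) t := by
    rw [lintegral_indicator measurableSet_Ioo, lintegral_const,
      Measure.restrict_apply_univ, Measure.restrict_apply measurableSet_Ioo,
      inter_eq_left.2 Ioo_subset_Ioi_self, Real.volume_Ioo, sub_zero, mul_comm]
  rw [e, ← lintegral_add_right _ (measurable_const.indicator measurableSet_Ioo)]
  refine setLIntegral_mono' measurableSet_Ioi fun t ht => ?_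
  by_cases htR : t < R
  · rw [indicator_of_mem (show t ∈ Ioo 0 R from ⟨ht, htR⟩)]
    exact h _ (measurableSet_lt measurable_const hg)
  · have : {x | t < g x} = ∅ := by
      ext x; simpa using (hR x).trans (not_lt.1 htR)
    simp [this]

lemma integral_le_add_of_measure_le {α : Type*} [MeasurableSpace α] {μ ν : Measure α}
    [IsFiniteMeasure μ] [IsFiniteMeasure ν]
    {T : ℝ} (hT : 0 ≤ T) (h : ∀ s, MeasurableSet s → μ s ≤ ν s + ENNReal.ofReal T) {g : α → ℝ}
    (hg : Measurable g) {R : ℝ} (hR0 : 0 ≤ R) (h0 : ∀ x, 0 ≤ g x) (hR : ∀ x, g x ≤ R) :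
    ∫ x, g x ∂μ ≤ ∫ x, g x ∂ν + R * T := by
  have hgi : Integrable g ν := Integrable.of_bound hg.aestronglyMeasurable R
    (Eventually.of_forall fun x => by rw [Real.norm_eq_abs, abs_of_nonneg (h0 x)]; exact hR x)
  have hI : 0 ≤ ∫ x, g x ∂ν := integral_nonneg h0
  refine integral_le_of_lintegral_le (by positivity) h0 hg ?_
  rw [ENNReal.ofReal_add hI (by positivity), ENNReal.ofReal_mul hR0,
    ofReal_integral_eq_lintegral_ofReal hgi (Eventually.of_forall h0)]
  exact lintegral_le_add_of_measure_le h hg h0 hR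

lemma measure_le_add_of_dTV_le {α : Type*} [MeasurableSpace α] {μ ν : Measure α} {D : ℝ≥0∞}
    (h : dTV μ ν ≤ D) (s : Set α) (hs : MeasurableSet s) : μ s ≤ ν s + D ∧ ν s ≤ μ s + D := by
  have h1 : μ s - ν s ≤ D :=
    ((le_iSup₂ (f := fun (s : Set α) (_ : MeasurableSet s) => μ s - ν s) s hs).trans
      le_self_add).trans h
  have h2 : ν s - μ s ≤ D :=
    ((le_iSup₂ (f := fun (s : Set α) (_ : MeasurableSet s) => ν s - μ s) s hs).trans
      le_add_self).trans h
  exact ⟨tsub_le_iff_left.1 h1, tsub_le_iff_left.1 h2⟩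

lemma integral_sub_le_of_dTV_le {α : Type*} [MeasurableSpace α] {μ ν : Measure α}
    [IsFiniteMeasure μ] [IsFiniteMeasure ν] {T : ℝ} (hT : 0 ≤ T)
    (h : dTV μ ν ≤ ENNReal.ofReal T) {g : α → ℝ} (hg : Measurable g) {R : ℝ} (hR0 : 0 ≤ R)
    (hR : ∀ x, |g x| ≤ R) : ∫ x, g x ∂μ - ∫ x, g x ∂ν ≤ 3 * R * T := by
  have hi : ∀ m : Measure α, IsFiniteMeasure m → Integrable g m := fun m _ =>
    Integrable.of_bound hg.aestronglyMeasurable R (Eventually.of_forall hR)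
  have h1 := integral_le_add_of_measure_le hT (fun s hs => (measure_le_add_of_dTV_le h s hs).1)
    (g := fun x => g x + R) (hg.add_const R) (R := 2 * R) (by positivity)
    (fun x => by linarith [(abs_le.1 (hR x)).1]) (fun x => by linarith [(abs_le.1 (hR x)).2])
  have h2 := integral_le_add_of_measure_le hT (fun s hs => (measure_le_add_of_dTV_le h s hs).2)
    (g := fun _ => R) measurable_const (R := R) hR0 (fun _ => hR0) (fun _ => le_rfl)
  rw [integral_add (hi μ inferInstance) (integrable_const R),
    integral_add (hi ν inferInstance) (integrable_const R)] at h1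
  linarith

/-- Test functions at a maximum point of the doubled functional, with the pointwise comparison of
the integrands of the associated Lévy operators. -/
lemma exists_tests_of_doubling {p k δ K : ℝ} (hp : 1 ≤ p) (hp2 : p ≤ 2) (hk : 0 ≤ k) (hδ : 0 < δ)
    (hδ1 : δ ≤ 1) {u v P : Euc d → ℝ} (hu : IsBUC u) (hv : IsBUC v) (hvK : ∀ x, |v x| ≤ K)
    (hP : ContDiff ℝ 2 P) {x₀ y₀ : Euc d}
    (hPk : ∀ h, P (x₀ - y₀ + h) - P (x₀ - y₀) ≤ fderiv ℝ P (x₀ - y₀) h + k * ‖h‖ ^ p)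
    (hmax : ∀ x y, u x - v y - P (x - y) ≤ u x₀ - v y₀ - P (x₀ - y₀)) :
    ∃ Φ Ψ : Euc d → ℝ, (ContDiff ℝ 2 Φ ∧ (∃ M, ∀ x, |Φ x| ≤ M) ∧ (∀ x, u x ≤ Φ x) ∧
      Φ x₀ = u x₀) ∧ (ContDiff ℝ 2 Ψ ∧ (∃ M, ∀ x, |Ψ x| ≤ M) ∧ (∀ x, Ψ x ≤ v x) ∧
      Ψ y₀ = v y₀) ∧
      (∀ z₁ ∈ ball (0 : Euc d) 1, ∀ z₂ ∈ ball (0 : Euc d) 1,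
        lopIntegrand Φ x₀ z₁ - lopIntegrand Ψ y₀ z₂ ≤ 4 * k * ‖z₁ - z₂‖ ^ p +
          ((ball (0 : Euc d) (2 * δ)).indicator (fun z => k * ‖z‖ ^ p) z₁ + δ * ‖z₁‖ ^ p) +
          ((ball (0 : Euc d) (2 * δ)).indicator (fun z => k * ‖z‖ ^ p) z₂ + δ * ‖z₂‖ ^ p)) ∧
      (∀ z ∉ ball (0 : Euc d) 1, lopIntegrand Φ x₀ z - lopIntegrand Ψ y₀ z ≤ 2 * δ ∧
        |lopIntegrand Ψ y₀ z| ≤ 2 * K + 1) := by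
  set a := x₀ - y₀ with ha
  have hPd : ∀ w, DifferentiableAt ℝ P w := fun w => hP.differentiable two_ne_zero w
  have hvn : IsBUC (fun x => -v x) := ⟨⟨K, fun x => by rw [abs_neg]; exact hvK x⟩, hv.2.neg⟩
  obtain ⟨Φ, hΦ, hΦb, huΦ, hΦx, hΦD, hΦ1, hΦ2⟩ := exists_bounded_test (p := p) (w := u)
    (P := fun x => P (x - y₀)) hp hu (hP.comp (contDiff_id.sub contDiff_const)) x₀
    (fun z => by have := hmax (x₀ + z) y₀; linarith) hδ hδ1
  obtain ⟨X, hX, ⟨M, hXb⟩, hvX, hXy, hXD, hX1, hX2⟩ := exists_bounded_test (p := p)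
    (w := fun x => -v x) (P := fun y => P (x₀ - y)) hp hvn
    (hP.comp (contDiff_const.sub contDiff_id)) y₀
    (fun z => by have := hmax x₀ (y₀ + z); linarith) hδ hδ1
  have hD1 : fderiv ℝ Φ x₀ = fderiv ℝ P a := by
    rw [hΦD, fderiv_comp_sub]
  have hD2 : fderiv ℝ (fun x => -X x) y₀ = fderiv ℝ P a := by
    rw [fderiv_fun_neg, hXD]
    have h1 : HasFDerivAt (fun y => x₀ - y) (-ContinuousLinearMap.id ℝ (Euc d)) y₀ :=
      (hasFDerivAt_id y₀).const_sub x₀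
    have h2 : HasFDerivAt (fun y => P (x₀ - y))
      ((fderiv ℝ P a).comp (-ContinuousLinearMap.id ℝ (Euc d))) y₀ :=
      (hPd a).hasFDerivAt.comp y₀ h1
    rw [h2.fderiv]
    ext z
    simp
  set q := fderiv ℝ P a with hq
  have eF : ∀ z ∈ ball (0 : Euc d) 1, lopIntegrand Φ x₀ z = Φ (x₀ + z) - u x₀ - q z :=
    fun z hz => by rw [lopIntegrand, indicator_of_mem hz, hD1, hΦx]
  have eG : ∀ z ∈ ball (0 : Euc d) 1,
      lopIntegrand (fun x => -X x) y₀ z = -X (y₀ + z) - v y₀ - q z :=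
    fun z hz => by rw [lopIntegrand, indicator_of_mem hz, hD2, hXy, neg_neg]
  have pw0 : ∀ z : Euc d, 0 ≤ ‖z‖ ^ p := fun z => by positivity
  have hpos : ∀ z : Euc d, 0 ≤ k * ‖z‖ ^ p := fun z => by positivity
  have hF : ∀ z ∈ ball (0 : Euc d) 1, lopIntegrand Φ x₀ z ≤ k * ‖z‖ ^ p + δ * ‖z‖ ^ p := by
    intro z hz
    have h1 := hΦ1 z
    have h2 := hPk z
    rw [show x₀ + z - y₀ = a + z by rw [ha]; abel] at h1
    rw [eF z hz]; linarith
  have hG : ∀ z ∈ ball (0 : Euc d) 1,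
      -lopIntegrand (fun x => -X x) y₀ z ≤ k * ‖z‖ ^ p + δ * ‖z‖ ^ p := by
    intro z hz
    have h1 := hX1 z
    have h2 := hPk (-z)
    rw [show x₀ - (y₀ + z) = a + -z by rw [ha]; abel] at h1
    rw [map_neg, norm_neg] at h2
    rw [eG z hz]; linarith
  have hFG : ∀ z₁ ∈ ball (0 : Euc d) 1, ∀ z₂ ∈ ball (0 : Euc d) 1, δ ≤ ‖z₁‖ → δ ≤ ‖z₂‖ →
      lopIntegrand Φ x₀ z₁ - lopIntegrand (fun x => -X x) y₀ z₂ ≤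
        k * ‖z₁ - z₂‖ ^ p + δ * ‖z₁‖ ^ p + δ * ‖z₂‖ ^ p := by
    intro z₁ hz₁ z₂ hz₂ h₁ h₂
    have h3 := (hΦ2 z₁ h₁).trans (add_le_add_right
      (mul_le_mul_of_nonneg_left (min_le_right 1 (‖z₁‖ ^ p)) hδ.le) _)
    have h4 := (hX2 z₂ h₂).trans (add_le_add_right
      (mul_le_mul_of_nonneg_left (min_le_right 1 (‖z₂‖ ^ p)) hδ.le) _)
    have h5 := hmax (x₀ + z₁) (y₀ + z₂)
    have h6 := hPk (z₁ - z₂)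
    rw [show x₀ + z₁ - (y₀ + z₂) = a + (z₁ - z₂) by rw [ha]; abel] at h5
    rw [map_sub] at h6
    rw [eF z₁ hz₁, eG z₂ hz₂]; linarith
  have hbig : ∀ z₁ z₂ : Euc d, 2 * δ ≤ ‖z₁‖ → ‖z₂‖ < δ → k * ‖z₁‖ ^ p ≤ 4 * k * ‖z₁ - z₂‖ ^ p := by
    intro z₁ z₂ h₁ h₂
    have h3 : ‖z₁‖ ≤ 2 * ‖z₁ - z₂‖ := by
      have := norm_sub_norm_le z₁ z₂; linarith
    have h4 : ‖z₁‖ ^ p ≤ 4 * ‖z₁ - z₂‖ ^ p := by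
      calc ‖z₁‖ ^ p ≤ (2 * ‖z₁ - z₂‖) ^ p := by gcongr
        _ = 2 ^ p * ‖z₁ - z₂‖ ^ p := Real.mul_rpow (by norm_num) (norm_nonneg _)
        _ ≤ 2 ^ (2 : ℝ) * ‖z₁ - z₂‖ ^ p := by gcongr; norm_num
        _ = 4 * ‖z₁ - z₂‖ ^ p := by norm_num
    calc k * ‖z₁‖ ^ p ≤ k * (4 * ‖z₁ - z₂‖ ^ p) := by gcongr
      _ = _ := by ring
  have hind : ∀ z : Euc d, 0 ≤ (ball (0 : Euc d) (2 * δ)).indicator (fun z => k * ‖z‖ ^ p) z :=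
    fun z => indicator_nonneg (fun z _ => hpos z) z
  have hind' : ∀ z : Euc d, ‖z‖ < 2 * δ →
      (ball (0 : Euc d) (2 * δ)).indicator (fun z => k * ‖z‖ ^ p) z = k * ‖z‖ ^ p :=
    fun z hz => indicator_of_mem (by simpa using hz) _
  refine ⟨Φ, fun x => -X x, ⟨hΦ, hΦb, huΦ, hΦx⟩, ⟨hX.neg, ⟨M, fun x => ?_⟩, fun x => ?_, ?_⟩,
    ?_, ?_⟩
  · rw [abs_neg]; exact hXb x
  · linarith [hvX x]
  · linarith [hXy]
  · intro z₁ hz₁ z₂ hz₂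
    have hk12 := hpos (z₁ - z₂)
    have i₁ := hind z₁
    have i₂ := hind z₂
    have hF' := hF z₁ hz₁
    have hG' := hG z₂ hz₂
    by_cases hboth : δ ≤ ‖z₁‖ ∧ δ ≤ ‖z₂‖
    · have := hFG z₁ hz₁ z₂ hz₂ hboth.1 hboth.2
      linarith
    · rcases lt_or_ge ‖z₁‖ (2 * δ) with h₁ | h₁
      · rw [hind' z₁ h₁]
        rcases lt_or_ge ‖z₂‖ (2 * δ) with h₂ | h₂
        · rw [hind' z₂ h₂]; linarith
        · have h₁' : ‖z₁‖ < δ := by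
            by_contra hc; exact hboth ⟨not_lt.1 hc, by linarith⟩
          have := hbig z₂ z₁ h₂ h₁'
          rw [norm_sub_rev] at this
          linarith
      · have h₂' : ‖z₂‖ < δ := by
          by_contra hc; exact hboth ⟨by linarith, not_lt.1 hc⟩
        have := hbig z₁ z₂ h₁ h₂'
        rw [hind' z₂ (by linarith)]
        linarith
  · intro z hz
    have hz1 : 1 ≤ ‖z‖ := by simpa using hz
    have h3 := (hΦ2 z (hδ1.trans hz1)).trans (add_le_add_right
      (mul_le_mul_of_nonneg_left (min_le_left 1 (‖z‖ ^ p)) hδ.le) _)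
    have h4 := (hX2 z (hδ1.trans hz1)).trans (add_le_add_right
      (mul_le_mul_of_nonneg_left (min_le_left 1 (‖z‖ ^ p)) hδ.le) _)
    have h5 := hmax (x₀ + z) (y₀ + z)
    rw [show x₀ + z - (y₀ + z) = a by rw [ha]; abel] at h5
    have h6 := hvX (y₀ + z)
    have h7 := abs_le.1 (hvK (y₀ + z))
    have h8 := abs_le.1 (hvK y₀)
    simp only [lopIntegrand, indicator_of_notMem hz, sub_zero]
    rw [hΦx, hXy]
    refine ⟨by linarith, ?_⟩
    rw [abs_le]; constructor <;> linarith

/-- Comparison of integrals against two Lévy measures which are close in transport distance near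
the origin and close in total variation away from it. -/
lemma integral_sub_integral_le {p k δ Λ t T D R : ℝ} (hp : 1 ≤ p) (hk : 0 ≤ k) (hδ : 0 < δ)
    (hδ1 : 2 * δ ≤ 1) (hΛ : 0 ≤ Λ) (ht : 0 ≤ t) (hT : 0 ≤ T) (hR : 0 ≤ R)
    {μ ν : Measure (Euc d)} (hμ : IsLevyLp p μ) (hν : IsLevyLp p ν)
    (hμΛ : ∫⁻ z, ENNReal.ofReal (min 1 (‖z‖ ^ p)) ∂μ ≤ ENNReal.ofReal Λ)
    (hνΛ : ∫⁻ z, ENNReal.ofReal (min 1 (‖z‖ ^ p)) ∂ν ≤ ENNReal.ofReal Λ)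
    (hμt : ∫⁻ z in ball (0 : Euc d) (2 * δ), ENNReal.ofReal (‖z‖ ^ p) ∂μ ≤ ENNReal.ofReal t)
    (hνt : ∫⁻ z in ball (0 : Euc d) (2 * δ), ENNReal.ofReal (‖z‖ ^ p) ∂ν ≤ ENNReal.ofReal t)
    (hTV : dTV (μ.restrict (ball (0 : Euc d) 1)ᶜ) (ν.restrict (ball (0 : Euc d) 1)ᶜ) ≤
      ENNReal.ofReal T)
    (hD : (dLpPow p (μ.restrict (ball (0 : Euc d) 1)) (ν.restrict (ball (0 : Euc d) 1))).toReal ≤ D)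
    {F G : Euc d → ℝ} (hFm : Measurable F) (hGm : Measurable G) (hF0 : F 0 = 0) (hG0 : G 0 = 0)
    (hF : Integrable F μ) (hG : Integrable G ν) (hGμ : Integrable G μ)
    (hnear : ∀ z₁ ∈ ball (0 : Euc d) 1, ∀ z₂ ∈ ball (0 : Euc d) 1,
      F z₁ - G z₂ ≤ 4 * k * ‖z₁ - z₂‖ ^ p +
        ((ball (0 : Euc d) (2 * δ)).indicator (fun z => k * ‖z‖ ^ p) z₁ + δ * ‖z₁‖ ^ p) +
        ((ball (0 : Euc d) (2 * δ)).indicator (fun z => k * ‖z‖ ^ p) z₂ + δ * ‖z₂‖ ^ p))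
    (hfar : ∀ z ∉ ball (0 : Euc d) 1, F z - G z ≤ 2 * δ ∧ |G z| ≤ R) :
    ∫ z, F z ∂μ - ∫ z, G z ∂ν ≤
      4 * k * (D + δ) + 2 * (k * t + δ * Λ) + 2 * δ * Λ + 3 * R * T := by
  have hp0 : 0 ≤ p := by linarith
  have hp0' : p ≠ 0 := by linarith
  set b := ball (0 : Euc d) 1 with hb
  set E : Euc d → ℝ := fun z =>
    (ball (0 : Euc d) (2 * δ)).indicator (fun z => k * ‖z‖ ^ p) z + δ * ‖z‖ ^ p with hE
  have hEm : Measurable E :=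
    (((measurable_norm_rpow p).const_mul k).indicator measurableSet_ball).add
      ((measurable_norm_rpow p).const_mul δ)
  have hE0 : E 0 = 0 := by simp [hE, Real.zero_rpow hp0']
  have hnormInt : ∀ m : Measure (Euc d), IsLevyLp p m →
      Integrable (fun z => ‖z‖ ^ p) (m.restrict b) := by
    intro m hm
    refine ⟨(measurable_norm_rpow p).aestronglyMeasurable, ?_⟩
    rw [hasFiniteIntegral_iff_ofReal (Eventually.of_forall fun z => by positivity)]
    exact (lintegral_ball_norm_rpow_le hp0).trans_lt hm.2
  have hEint : ∀ m : Measure (Euc d), IsLevyLp p m → Integrable E (m.restrict b) := fun m hm =>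
    (((hnormInt m hm).const_mul k).indicator measurableSet_ball).add ((hnormInt m hm).const_mul δ)
  have hEle : ∀ m : Measure (Euc d), IsLevyLp p m →
      ∫⁻ z, ENNReal.ofReal (min 1 (‖z‖ ^ p)) ∂m ≤ ENNReal.ofReal Λ →
      ∫⁻ z in ball (0 : Euc d) (2 * δ), ENNReal.ofReal (‖z‖ ^ p) ∂m ≤ ENNReal.ofReal t →
      ∫ z in b, E z ∂m ≤ k * t + δ * Λ := by
    intro m hm hmΛ hmt
    rw [integral_add (((hnormInt m hm).const_mul k).indicator measurableSet_ball)
      ((hnormInt m hm).const_mul δ), integral_indicator measurableSet_ball,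
      Measure.restrict_restrict measurableSet_ball,
      inter_eq_left.2 (ball_subset_ball hδ1), integral_const_mul, integral_const_mul]
    gcongr
    · exact integral_le_of_lintegral_le ht (fun z => by positivity) (measurable_norm_rpow p) hmt
    · exact integral_le_of_lintegral_le hΛ (fun z => by positivity) (measurable_norm_rpow p)
        ((lintegral_ball_norm_rpow_le hp0).trans hmΛ)
  have hfin : ∀ m : Measure (Euc d), IsLevyLp p m → IsFiniteMeasure (m.restrict bᶜ) := fun m hm =>
    ⟨by rw [Measure.restrict_apply_univ]; exact (measure_compl_ball_le hp0).trans_lt hm.2⟩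
  have : IsFiniteMeasure (μ.restrict bᶜ) := hfin μ hμ
  have : IsFiniteMeasure (ν.restrict bᶜ) := hfin ν hν
  -- the part near the origin
  have hnearInt : ∫ z in b, F z ∂μ - ∫ z in b, G z ∂ν ≤
      4 * k * (D + δ) + 2 * (k * t + δ * Λ) := by
    have hres0 : ∀ m : Measure (Euc d), m {0} = 0 → m.restrict b {0} = 0 := fun m hm =>
      le_antisymm ((Measure.restrict_apply_le b {0}).trans hm.le) zero_le
    have htop : dLpPow p (μ.restrict b) (ν.restrict b) ≠ ⊤ :=
      dLpPow_ne_top (hres0 μ hμ.1) (hres0 ν hν.1)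
        ((lintegral_ball_norm_rpow_le hp0).trans_lt hμ.2).ne
        ((lintegral_ball_norm_rpow_le hp0).trans_lt hν.2).ne
    have hlt : dLpPow p (μ.restrict b) (ν.restrict b) < ENNReal.ofReal (D + δ) :=
      (ENNReal.lt_ofReal_iff_toReal_lt htop).2 (by linarith)
    obtain ⟨γ, hγ⟩ := iInf_lt_iff.1 hlt
    obtain ⟨hγadm, hγJ⟩ := iInf_lt_iff.1 hγ
    have hJ : Jp p γ ≠ ⊤ := hγJ.ne_top
    have hD0 : 0 ≤ D := ENNReal.toReal_nonneg.trans hD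
    have hJle : (Jp p γ).toReal ≤ D + δ := ENNReal.toReal_le_of_le_ofReal (by linarith) hγJ.le
    have hc : ∀ m : Measure (Euc d), m.restrict b bᶜ = 0 := fun m => by
      rw [Measure.restrict_apply measurableSet_ball.compl, compl_inter_self, measure_empty]
    have key := integral_sub_le_of_mem_admPlan (k := 4 * k) hγadm hJ (S := b) measurableSet_ball
      (by simp [hb]) (hc μ) (hc ν) (F := fun z => F z - E z) (G := fun z => G z + E z)
      (hFm.sub hEm) (hGm.add hEm) (by simp [hF0, hE0]) (by simp [hG0, hE0])
      (hF.restrict.sub (hEint μ hμ)) (hG.restrict.add (hEint ν hν))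
      (fun x hx y hy => by have := hnear x hx y hy; simp only [hE]; linarith)
    rw [integral_sub hF.restrict (hEint μ hμ), integral_add hG.restrict (hEint ν hν)] at key
    have h1 := hEle μ hμ hμΛ hμt
    have h2 := hEle ν hν hνΛ hνt
    have h3 : 4 * k * (Jp p γ).toReal ≤ 4 * k * (D + δ) := by gcongr
    linarith
  -- the part away from the origin
  have hfarInt : ∫ z in bᶜ, F z ∂μ - ∫ z in bᶜ, G z ∂ν ≤ 2 * δ * Λ + 3 * R * T := by
    have h1 : ∫ z in bᶜ, F z ∂μ - ∫ z in bᶜ, G z ∂μ ≤ 2 * δ * Λ := by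
      rw [← integral_sub hF.restrict hGμ.restrict]
      calc ∫ z in bᶜ, (F z - G z) ∂μ ≤ ∫ z in bᶜ, 2 * δ ∂μ :=
            setIntegral_mono_on (hF.sub hGμ).integrableOn (integrable_const _)
              measurableSet_ball.compl fun z hz => (hfar z hz).1
        _ = μ.real bᶜ * (2 * δ) := by simp
        _ ≤ Λ * (2 * δ) := by
          gcongr
          exact ENNReal.toReal_le_of_le_ofReal hΛ ((measure_compl_ball_le hp0).trans hμΛ)
        _ = _ := by ring
    have h2 := integral_sub_le_of_dTV_le hT hTV (g := bᶜ.indicator G)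
      (hGm.indicator measurableSet_ball.compl) hR (fun z => by
        by_cases hz : z ∈ b
        · rw [indicator_of_notMem (by simpa using hz)]; simpa using hR
        · rw [indicator_of_mem hz]; exact (hfar z hz).2)
    rw [setIntegral_indicator measurableSet_ball.compl,
      setIntegral_indicator measurableSet_ball.compl, inter_self] at h2
    linarith
  rw [← integral_add_compl (measurableSet_ball : MeasurableSet b) hF,
    ← integral_add_compl (measurableSet_ball : MeasurableSet b) hG]
  linarith

lemma exists_pos_le_of_isModulus {θ : ℝ → ℝ} (hθ : IsModulus θ) {τ : ℝ} (hτ : 0 < τ) :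
    ∃ r, 0 < r ∧ ∀ s ≤ r, θ s ≤ τ := by
  have h := hθ.2.2.eventually (Iio_mem_nhds hτ)
  obtain ⟨r, hr, hr'⟩ := (h.and self_mem_nhdsWithin).exists
  exact ⟨r, hr', fun s hs => (hθ.2.1 hs).trans (le_of_lt hr)⟩

lemma exists_pos_abs_sub_le {u : Euc d → ℝ} (hu : UniformContinuous u) {τ : ℝ} (hτ : 0 < τ) :
    ∃ r, 0 < r ∧ ∀ x y, ‖x - y‖ ≤ r → |u x - u y| ≤ τ := by
  obtain ⟨r, hr, h⟩ := Metric.uniformContinuous_iff.1 hu τ hτ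
  refine ⟨r / 2, by positivity, fun x y hxy => ?_⟩
  have := h (a := x) (b := y) (by rw [dist_eq_norm]; linarith)
  rw [Real.dist_eq] at this
  exact this.le

/-- The doubled functional attains its global maximum inside `O × O`. -/
lemma exists_doubling_max {O : Set (Euc d)} (hO : Bornology.IsBounded O)
    {u v P : Euc d → ℝ} (hu : Continuous u) (hv : Continuous v) (hP : Continuous P)
    (hbc : ∀ x ∉ O, u x ≤ v x) {m τ r K : ℝ} {x₁ : Euc d} (hx₁ : x₁ ∈ O)
    (hm : u x₁ - v x₁ = m) (hmax : ∀ x, u x - v x ≤ m) (hτ : 0 < τ) (hτm : τ < m)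
    (huK : ∀ x, |u x| ≤ K) (hvK : ∀ x, |v x| ≤ K)
    (hur : ∀ x y, ‖x - y‖ ≤ r → |u x - u y| ≤ τ) (hvr : ∀ x y, ‖x - y‖ ≤ r → |v x - v y| ≤ τ)
    (hP0 : P 0 = 0) (hPnn : ∀ x, 0 ≤ P x) (hPr : ∀ x, r < ‖x‖ → 2 * K ≤ P x) :
    ∃ x₀ ∈ O, ∃ y₀ ∈ O, (∀ x y, u x - v y - P (x - y) ≤ u x₀ - v y₀ - P (x₀ - y₀)) ∧
      ‖x₀ - y₀‖ ≤ r ∧ P (x₀ - y₀) ≤ τ ∧ m ≤ u x₀ - v y₀ := by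
  have hfar : ∀ x y, r < ‖x - y‖ → u x - v y - P (x - y) ≤ τ := fun x y h => by
    have h1 := (abs_le.1 (huK x)).2
    have h2 := (abs_le.1 (hvK y)).1
    linarith [hPr _ h]
  have hout : ∀ x y, (x ∉ O ∨ y ∉ O) → u x - v y - P (x - y) ≤ τ := by
    intro x y hxy
    rcases lt_or_ge r ‖x - y‖ with h | h
    · exact hfar x y h
    · have hp := hPnn (x - y)
      rcases hxy with hx | hy
      · linarith [hbc x hx, (abs_le.1 (hvr x y h)).2]
      · linarith [hbc y hy, (abs_le.1 (hur x y h)).2]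
  have hcpt : IsCompact (closure O ×ˢ closure O) :=
    hO.isCompact_closure.prod hO.isCompact_closure
  obtain ⟨⟨x₀, y₀⟩, -, hq⟩ := hcpt.exists_isMaxOn
    (f := fun q : Euc d × Euc d => u q.1 - v q.2 - P (q.1 - q.2))
    ⟨(x₁, x₁), subset_closure hx₁, subset_closure hx₁⟩
    (by fun_prop : Continuous fun q : Euc d × Euc d =>
      u q.1 - v q.2 - P (q.1 - q.2)).continuousOn
  have hval : m ≤ u x₀ - v y₀ - P (x₀ - y₀) := by
    have := hq (show ((x₁, x₁) : Euc d × Euc d) ∈ closure O ×ˢ closure O from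
      ⟨subset_closure hx₁, subset_closure hx₁⟩)
    simp only [mem_ofPred_eq, sub_self, hP0, sub_zero, hm] at this
    exact this
  have hx₀ : x₀ ∈ O := by
    by_contra h; linarith [hout x₀ y₀ (Or.inl h)]
  have hy₀ : y₀ ∈ O := by
    by_contra h; linarith [hout x₀ y₀ (Or.inr h)]
  have hr : ‖x₀ - y₀‖ ≤ r := by
    by_contra h; linarith [hfar x₀ y₀ (not_le.1 h)]
  refine ⟨x₀, hx₀, y₀, hy₀, fun x y => ?_, hr, ?_, ?_⟩
  · by_cases hxy : x ∈ O ∧ y ∈ O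
    · exact hq (show ((x, y) : Euc d × Euc d) ∈ closure O ×ˢ closure O from
        ⟨subset_closure hxy.1, subset_closure hxy.2⟩)
    · have := hout x y (by tauto)
      linarith
  · linarith [hmax y₀, (abs_le.1 (hur x₀ y₀ hr)).2]
  · linarith [hPnn (x₀ - y₀)]

lemma iSup_iInf_add_le {ι κ : Type*} [Nonempty ι] [Nonempty κ] {F G : ι → κ → ℝ} {R ρ : ℝ}
    (hF : ∀ i j, |F i j| ≤ R) (hG : ∀ i j, |G i j| ≤ R) (h : ∀ i j, G i j + ρ ≤ F i j) :
    (⨆ i, ⨅ j, G i j) + ρ ≤ ⨆ i, ⨅ j, F i j := by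
  have bF : ∀ i, BddBelow (range (F i)) := fun i =>
    ⟨-R, by rintro _ ⟨j, rfl⟩; exact (abs_le.1 (hF i j)).1⟩
  have bG : ∀ i, BddBelow (range (G i)) := fun i =>
    ⟨-R, by rintro _ ⟨j, rfl⟩; exact (abs_le.1 (hG i j)).1⟩
  have bS : BddAbove (range fun i => ⨅ j, F i j) := by
    refine ⟨R, ?_⟩
    rintro _ ⟨i, rfl⟩
    obtain ⟨j⟩ := ‹Nonempty κ›
    exact (ciInf_le (bF i) j).trans (abs_le.1 (hF i j)).2
  rw [← le_sub_iff_add_le]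
  refine ciSup_le fun i => ?_
  rw [le_sub_iff_add_le]
  refine le_trans ?_ (le_ciSup bS i)
  exact le_ciInf fun j => (add_le_add_left (ciInf_le (bG i) j) ρ).trans (h i j)

lemma dLpPow_toReal_le {p s : ℝ} (hp : 1 ≤ p) {μ ν : Measure (Euc d)} (h : dLp p μ ν ≤ s) :
    (dLpPow p μ ν).toReal ≤ s ^ p := by
  have h0 : 0 ≤ (dLpPow p μ ν).toReal := ENNReal.toReal_nonneg
  calc (dLpPow p μ ν).toReal = dLp p μ ν ^ p := by
        rw [dLp, one_div, Real.rpow_inv_rpow h0 (by linarith)]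
    _ ≤ s ^ p := Real.rpow_le_rpow (Real.rpow_nonneg h0 _) h (by linarith)

set_option maxHeartbeats 1000000 in
/-- Theorem 4.8 (main comparison principle): under Assumptions A–E, a bounded uniformly
continuous viscosity subsolution `u` and supersolution `v` of equation (E) with `u ≤ v`
outside the bounded domain `𝒪` satisfy `u ≤ v` in `𝒪`. -/
theorem main_comparison_principle
    {d : ℕ} {A B : Type*} [Nonempty A] [Nonempty B]
    (O : Set (Euc d)) (hOopen : IsOpen O) (hObdd : Bornology.IsBounded O)
    (hOconn : IsConnected O)
    (p : ℝ) (hp1 : 1 ≤ p) (hp2 : p ≤ 2)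
    (μf : Euc d → A → B → Measure (Euc d)) (c f : A → B → Euc d → ℝ)
    (hLevy : ∀ x ∈ O, ∀ (α : A) (β : B), IsLevyLp p (μf x α β))
    (hA : AssumptionA O p (fun x α β => (μf x α β).restrict (ball (0 : Euc d) 1)))
    (hB : AssumptionB O (fun x α β => (μf x α β).restrict (ball (0 : Euc d) 1)ᶜ))
    (hC : AssumptionC O f) (hD : AssumptionD O c) (hE : AssumptionE O p μf)
    (u v : Euc d → ℝ) (hu : IsBUC u) (hv : IsBUC v)
    (hsub : IsSubsolution O (Iop μf c f) u)
    (hsup : IsSupersolution O (Iop μf c f) v)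
    (hbc : ∀ x ∉ O, u x ≤ v x) :
    ∀ x ∈ O, u x ≤ v x := by
  obtain ⟨C, hC0, hA⟩ := hA
  obtain ⟨θB, hθB, hB⟩ := hB
  obtain ⟨θf, hθf, Cf, -, hfθ, hfC⟩ := hC
  obtain ⟨lam, lam1, hlam, -, hcb, θc, hθc, hcθ⟩ := hD
  obtain ⟨⟨θE, hθE, hEθ⟩, Λ, hΛ, hEΛ⟩ := hE
  obtain ⟨Ku, hKu⟩ := hu.1
  obtain ⟨Kv, hKv⟩ := hv.1
  have hcu : Continuous u := hu.2.continuous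
  have hcv : Continuous v := hv.2.continuous
  intro w hw
  by_contra hwlt
  obtain ⟨x₁, -, hx₁max⟩ := hObdd.isCompact_closure.exists_isMaxOn ⟨w, subset_closure hw⟩
    (hcu.sub hcv).continuousOn
  set m : ℝ := u x₁ - v x₁ with hm
  have hwm : u w - v w ≤ m := hx₁max (subset_closure hw)
  have hmpos : 0 < m := by linarith
  have hx₁ : x₁ ∈ O := by
    by_contra h; linarith [hbc x₁ h]
  have hmax : ∀ x, u x - v x ≤ m := fun x => by
    by_cases hx : x ∈ O
    · exact hx₁max (subset_closure hx)
    · linarith [hbc x hx]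
  -- constants
  set K : ℝ := max Ku Kv with hK
  have huK : ∀ x, |u x| ≤ K := fun x => (hKu x).trans (le_max_left _ _)
  have hvK : ∀ x, |v x| ≤ K := fun x => (hKv x).trans (le_max_right _ _)
  have hK0 : 0 ≤ K := (abs_nonneg _).trans (huK w)
  set S : ℝ := 48 * C ^ p + 7 * K + 5 with hS
  have hS0 : 0 < S := by positivity
  set τ : ℝ := min (m / 2) (lam * m / (2 * S)) with hτdef
  have hτ : 0 < τ := lt_min (by positivity) (by positivity)
  have hτm : τ < m := (min_le_left _ _).trans_lt (by linarith)
  have hτS : τ * S < lam * m := by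
    have : τ ≤ lam * m / (2 * S) := min_le_right _ _
    rw [le_div_iff₀ (by positivity)] at this
    have : 0 < τ * S := by positivity
    linarith
  obtain ⟨ru, hru, hur⟩ := exists_pos_abs_sub_le hu.2 hτ
  obtain ⟨rv, hrv, hvr⟩ := exists_pos_abs_sub_le hv.2 hτ
  obtain ⟨rB, hrB, hBr⟩ := exists_pos_le_of_isModulus hθB hτ
  obtain ⟨rf, hrf, hfr⟩ := exists_pos_le_of_isModulus hθf hτ
  obtain ⟨rc, hrc, hcr⟩ := exists_pos_le_of_isModulus hθc hτ
  obtain ⟨r, hr, hr₁, hr₂, hr₃, hr₄, hr₅⟩ : ∃ r : ℝ, 0 < r ∧ r ≤ ru ∧ r ≤ rv ∧ r ≤ rB ∧ r ≤ rf ∧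
      r ≤ rc := by
    refine ⟨min ru (min rv (min rB (min rf rc))), by positivity, ?_⟩
    simp
  -- the penalization
  set ε : ℝ := r ^ p / (2 * K + τ) with hε
  have hrp : 0 < r ^ p := Real.rpow_pos_of_pos hr p
  have hε0 : 0 < ε := by positivity
  obtain ⟨κ, hκ, hκp⟩ : ∃ κ : ℝ, 0 < κ ∧ κ ^ (p / 2) = ε * τ :=
    ⟨(ε * τ) ^ (p / 2)⁻¹, by positivity, Real.rpow_inv_rpow (by positivity) (by positivity)⟩
  set P : Euc d → ℝ := fun x => ε⁻¹ * psiK p κ x with hPdef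
  have hP2 : ContDiff ℝ 2 P := contDiff_const.mul (contDiff_psiK hκ)
  have hPnorm : ∀ x, ε⁻¹ * ‖x‖ ^ p ≤ P x + τ := fun x => by
    have h1 := rpow_norm_le_psiK (p := p) (by linarith) hκ x
    rw [hκp] at h1
    calc ε⁻¹ * ‖x‖ ^ p ≤ ε⁻¹ * (psiK p κ x + ε * τ) := by gcongr
      _ = P x + τ := by simp only [hPdef]; field_simp
  obtain ⟨x₀, hx₀, y₀, hy₀, hdbl, hxy, hPτ, hmle⟩ := exists_doubling_max hObdd hcu hcv
    hP2.continuous hbc hx₁ rfl hmax hτ hτm huK hvK (fun x y h => hur x y (h.trans hr₁))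
    (fun x y h => hvr x y (h.trans hr₂)) (by simp [hPdef, psiK_zero])
    (fun x => mul_nonneg (by positivity) (psiK_nonneg (by linarith) hκ x))
    (fun x hx => by
      have h1 := hPnorm x
      have h2 : ε⁻¹ * r ^ p ≤ ε⁻¹ * ‖x‖ ^ p := by gcongr
      have h3 : ε⁻¹ * r ^ p = 2 * K + τ := by rw [hε]; field_simp
      linarith)
  set k : ℝ := ε⁻¹ * 6 with hk
  have hk0 : 0 < k := by positivity
  have hPk : ∀ h, P (x₀ - y₀ + h) - P (x₀ - y₀) ≤ fderiv ℝ P (x₀ - y₀) h + k * ‖h‖ ^ p := by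
    intro h
    have h1 := psiK_add_le hp1 hp2 hκ (x₀ - y₀) h
    rw [((hasFDerivAt_psiK hκ (x₀ - y₀)).const_mul ε⁻¹).fderiv]
    simp only [hPdef, smul_apply, innerSL_apply_apply, smul_eq_mul]
    rw [← mul_sub]
    calc _ ≤ ε⁻¹ * _ := mul_le_mul_of_nonneg_left h1 (by positivity)
      _ = _ := by rw [hk]; ring
  -- the scale separating small and large jumps
  obtain ⟨s, hs, hEs⟩ := exists_pos_le_of_isModulus hθE (τ := τ / (8 * k)) (by positivity)
  obtain ⟨δ, hδ, hδ₁, hδs, hδk, hδΛ⟩ : ∃ δ : ℝ, 0 < δ ∧ δ ≤ 1 / 2 ∧ δ ≤ s / 2 ∧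
      δ ≤ τ / (8 * k) ∧ δ ≤ τ / (16 * (Λ + 1)) := by
    refine ⟨min (1 / 2) (min (s / 2) (min (τ / (8 * k)) (τ / (16 * (Λ + 1))))), by positivity, ?_⟩
    simp
  obtain ⟨Φ, Ψ, ⟨hΦ, hΦb, huΦ, hΦx⟩, ⟨hΨ, hΨb, hΨv, hΨy⟩, hnear, hfar⟩ :=
    exists_tests_of_doubling hp1 hp2 hk0.le hδ (by linarith) hu hv hvK hP2 hPk hdbl
  have hI1 : Iop μf c f Φ x₀ ≤ 0 :=
    hsub Φ hΦ hΦb x₀ hx₀ (fun y => by linarith [huΦ y]) hΦx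
  have hI2 : 0 ≤ Iop μf c f Ψ y₀ :=
    hsup Ψ hΨ hΨb y₀ hy₀ (fun y => by linarith [hΨv y]) hΨy
  have hL : ∀ α β, Lop (μf x₀ α β) Φ x₀ - Lop (μf y₀ α β) Ψ y₀ ≤
      τ * (48 * C ^ p + 6 * K + 4) := by
    intro α β
    have h := integral_sub_integral_le (D := (C * ‖x₀ - y₀‖) ^ p) (T := τ) (R := 2 * K + 1)
      (t := τ / (8 * k))
      hp1 hk0.le hδ (by linarith) hΛ (by positivity) hτ.le (by positivity) (hLevy x₀ hx₀ α β)
      (hLevy y₀ hy₀ α β) (hEΛ x₀ hx₀ α β) (hEΛ y₀ hy₀ α β)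
      ((hEθ (2 * δ) (by positivity) x₀ hx₀ α β).trans
        (ENNReal.ofReal_le_ofReal (hEs _ (by linarith))))
      ((hEθ (2 * δ) (by positivity) y₀ hy₀ α β).trans
        (ENNReal.ofReal_le_ofReal (hEs _ (by linarith))))
      ((hB x₀ hx₀ y₀ hy₀ α β).trans (ENNReal.ofReal_le_ofReal (hBr _ (hxy.trans hr₃))))
      (dLpPow_toReal_le hp1 (hA x₀ hx₀ y₀ hy₀ α β))
      (measurable_lopIntegrand hΦ.continuous x₀) (measurable_lopIntegrand hΨ.continuous y₀)
      (lopIntegrand_zero Φ x₀) (lopIntegrand_zero Ψ y₀)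
      (integrable_lopIntegrand hp1 hp2 hΦ hΦb x₀ (hLevy x₀ hx₀ α β))
      (integrable_lopIntegrand hp1 hp2 hΨ hΨb y₀ (hLevy y₀ hy₀ α β))
      (integrable_lopIntegrand hp1 hp2 hΨ hΨb y₀ (hLevy x₀ hx₀ α β)) hnear hfar
    refine le_trans h ?_
    have e1 : 4 * k * (C * ‖x₀ - y₀‖) ^ p ≤ 48 * C ^ p * τ := by
      rw [Real.mul_rpow hC0 (norm_nonneg _), hk]
      have h1 := hPnorm (x₀ - y₀)
      have h2 : ε⁻¹ * ‖x₀ - y₀‖ ^ p ≤ 2 * τ := by linarith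
      calc 4 * (ε⁻¹ * 6) * (C ^ p * ‖x₀ - y₀‖ ^ p) = 24 * C ^ p * (ε⁻¹ * ‖x₀ - y₀‖ ^ p) := by ring
        _ ≤ 24 * C ^ p * (2 * τ) := by gcongr
        _ = _ := by ring
    have e2 : k * (τ / (8 * k)) = τ / 8 := by field_simp
    have e3 : k * δ ≤ τ / 8 := by
      calc k * δ ≤ k * (τ / (8 * k)) := by gcongr
        _ = _ := e2
    have e4 : δ * Λ ≤ τ / 16 := by
      rw [le_div_iff₀ (by positivity)] at hδΛ
      linarith
    rw [e2]
    linarith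
  obtain ⟨R₁, hR₁⟩ := exists_abs_Lop_le hp1 hp2 hΦ hΦb x₀ hΛ
  obtain ⟨R₂, hR₂⟩ := exists_abs_Lop_le hp1 hp2 hΨ hΨb y₀ hΛ
  have hbd : ∀ L R' c' w' f' : ℝ, |L| ≤ R' → lam ≤ c' → c' ≤ lam1 → |w'| ≤ K → |f'| ≤ Cf →
      |-L + c' * w' + f'| ≤ R' + lam1 * K + Cf := by
    intro L R' c' w' f' h1 h2 h3 h4 h5
    have h6 : |c' * w'| ≤ lam1 * K := by
      rw [abs_mul, abs_of_pos (hlam.trans_le h2)]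
      exact mul_le_mul h3 h4 (abs_nonneg _) (hlam.le.trans (h2.trans h3))
    calc _ ≤ |-L| + |c' * w'| + |f'| := abs_add_three _ _ _
      _ ≤ _ := by rw [abs_neg]; linarith
  have hfinal := iSup_iInf_add_le (ρ := lam * m - τ * S)
    (R := max R₁ R₂ + lam1 * K + Cf)
    (F := fun α β => -(Lop (μf x₀ α β) Φ x₀) + c α β x₀ * Φ x₀ + f α β x₀)
    (G := fun α β => -(Lop (μf y₀ α β) Ψ y₀) + c α β y₀ * Ψ y₀ + f α β y₀)
    (fun α β => hbd _ _ _ _ _ ((hR₁ _ (hLevy x₀ hx₀ α β) (hEΛ x₀ hx₀ α β)).trans (le_max_left _ _))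
      (hcb x₀ hx₀ α β).1 (hcb x₀ hx₀ α β).2 (by rw [hΦx]; exact huK x₀) (hfC x₀ hx₀ α β))
    (fun α β => hbd _ _ _ _ _ ((hR₂ _ (hLevy y₀ hy₀ α β) (hEΛ y₀ hy₀ α β)).trans (le_max_right _ _))
      (hcb y₀ hy₀ α β).1 (hcb y₀ hy₀ α β).2 (by rw [hΨy]; exact hvK y₀) (hfC y₀ hy₀ α β))
    (fun α β => by
      have h1 := hL α β
      have h2 := (abs_le.1 ((hfθ x₀ hx₀ y₀ hy₀ α β).trans (hfr _ (hxy.trans hr₄)))).1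
      have h3 := (hcθ x₀ hx₀ y₀ hy₀ α β).trans (hcr _ (hxy.trans hr₅))
      have h4 : lam * m ≤ c α β x₀ * (u x₀ - v y₀) :=
        mul_le_mul (hcb x₀ hx₀ α β).1 hmle hmpos.le (hlam.le.trans (hcb x₀ hx₀ α β).1)
      have h5 : -(τ * K) ≤ (c α β x₀ - c α β y₀) * v y₀ := by
        refine (abs_le.1 ?_).1
        rw [abs_mul]
        exact mul_le_mul h3 (hvK y₀) (abs_nonneg _) hτ.le
      rw [hΦx, hΨy, hS]
      linarith)
  have hpos : 0 < lam * m - τ * S := by linarith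
  unfold Iop at hI1 hI2
  linarith
end
end

section
/- Let 𝒪 ⊂ ℝ^d be a bounded domain and let Assumptions C and D hold. Suppose the measures are of the form dμ_x^{αβ}(z) = K_{αβ}(x,z)dz where, for some σ ∈ (0,1) and constants Λ₁ > 0, C ≥ 0: 0 ≤ K_{αβ}(x,z) ≤ K(z) := Λ₁|z|^{−(d+σ)} and |K_{αβ}(x,z) − K_{αβ}(y,z)| ≤ C|x−y| K(z) for all x, y ∈ 𝒪, z ≠ 0, α, β. Then Assumption B holds, Assumptions A and E hold with p = 1, and the comparison principle holds for (E): if u is a viscosity subsolution and v a viscosity supersolution of (E) with u ≤ v outside 𝒪, then u ≤ v in 𝒪. -/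
open MeasureTheory Set Metric Filter
open scoped ENNReal NNReal

noncomputable section

variable {d : ℕ} {A B : Type*}

/-- The increment `φ(x+z) - φ(x) - χ_{B₁}(z) Dφ(x)·z` integrated by the Lévy operator. -/
def levyIncrement (φ : Euc d → ℝ) (x z : Euc d) : ℝ :=
  φ (x + z) - φ x - (ball (0 : Euc d) 1).indicator (fun w => fderiv ℝ φ x w) z

theorem abs_indicator_ball_apply_le (p : Euc d →L[ℝ] ℝ) (z : Euc d) :
    |(ball (0 : Euc d) 1).indicator (fun w => p w) z| ≤ ‖p‖ * min 1 ‖z‖ := by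
  by_cases hz : z ∈ ball (0 : Euc d) 1
  · rw [indicator_of_mem hz]
    rw [mem_ball_zero_iff] at hz
    rw [min_eq_right hz.le]
    exact p.le_opNorm z
  · rw [indicator_of_notMem hz]
    simp only [abs_zero]
    positivity

theorem measurable_levyIncrement {φ : Euc d → ℝ} (hφ : Continuous φ) (x : Euc d) :
    Measurable (levyIncrement φ x) := by
  unfold levyIncrement
  refine Measurable.sub (by fun_prop) (Measurable.indicator ?_ measurableSet_ball)
  exact (fderiv ℝ φ x).continuous.measurable

/-- Increments of bounded `C²` functions are controlled by `min(1,|z|)`. -/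
theorem exists_abs_levyIncrement_le {φ : Euc d → ℝ} (hφ : ContDiff ℝ 2 φ)
    (hb : ∃ M, ∀ x, |φ x| ≤ M) (x : Euc d) :
    ∃ L, 0 ≤ L ∧ ∀ z, |levyIncrement φ x z| ≤ L * min 1 ‖z‖ := by
  obtain ⟨M, hM⟩ := hb
  have hM0 : 0 ≤ M := (abs_nonneg _).trans (hM 0)
  have hcont : Continuous (fun y => ‖fderiv ℝ φ y‖) :=
    (hφ.continuous_fderiv (by norm_num)).norm
  obtain ⟨L, hL⟩ := (isCompact_closedBall x 1).exists_bound_of_continuousOn hcont.continuousOn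
  have hL0 : 0 ≤ L := (norm_nonneg _).trans (hL x (mem_closedBall_self zero_le_one))
  have key : ∀ z : Euc d, |φ (x + z) - φ x| ≤ (L + 2 * M) * min 1 ‖z‖ := by
    intro z
    rcases le_total ‖z‖ 1 with hz | hz
    · rw [min_eq_right hz]
      have := (convex_closedBall x 1).norm_image_sub_le_of_norm_fderiv_le (f := φ) (𝕜 := ℝ)
        (C := L) (x := x) (y := x + z)
        (fun y _ => (hφ.differentiable (by norm_num)).differentiableAt)
        (fun y hy => by simpa using hL y hy) (mem_closedBall_self zero_le_one)
        (by simpa [mem_closedBall, dist_eq_norm] using hz)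
      rw [add_sub_cancel_left, Real.norm_eq_abs] at this
      nlinarith [norm_nonneg z]
    · rw [min_eq_left hz]
      have h1 := hM (x + z)
      have h2 := hM x
      rw [abs_le] at *
      constructor <;> linarith [h1.1, h1.2, h2.1, h2.2]
  refine ⟨L + 2 * M + ‖fderiv ℝ φ x‖, by positivity, fun z => ?_⟩
  have h1 := key z
  have h2 := abs_indicator_ball_apply_le (fderiv ℝ φ x) z
  unfold levyIncrement
  calc _ ≤ |φ (x + z) - φ x| + |(ball (0 : Euc d) 1).indicator (fun w => fderiv ℝ φ x w) z| :=
        abs_sub _ _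
    _ ≤ _ := by linarith

theorem integrable_levyIncrement {ν : Measure (Euc d)}
    (hν : Integrable (fun z : Euc d => min 1 ‖z‖) ν)
    {φ : Euc d → ℝ} (hφ : ContDiff ℝ 2 φ) (hb : ∃ M, ∀ x, |φ x| ≤ M) (x : Euc d) :
    Integrable (levyIncrement φ x) ν := by
  obtain ⟨L, -, hL⟩ := exists_abs_levyIncrement_le hφ hb x
  exact (hν.const_mul L).mono' (measurable_levyIncrement hφ.continuous x).aestronglyMeasurable
    (ae_of_all _ hL)

theorem integrable_min_norm_s1 {ν : Measure (Euc d)}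
    (hν : Integrable (fun z : Euc d => min 1 ‖z‖) ν) {s : ℝ} (hs0 : 0 ≤ s) (hs : s ≤ 1) :
    Integrable (fun z : Euc d => min s ‖z‖) ν := by
  refine hν.mono' (by fun_prop) (ae_of_all _ fun z => ?_)
  rw [Real.norm_of_nonneg (le_min hs0 (norm_nonneg z))]
  exact min_le_min_right _ hs

theorem tendsto_integral_min_norm {ν : Measure (Euc d)}
    (hν : Integrable (fun z : Euc d => min 1 ‖z‖) ν) :
    Tendsto (fun s => ∫ z, min s ‖z‖ ∂ν) (nhdsWithin 0 (Ioi 0)) (nhds 0) := by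
  have h := tendsto_integral_filter_of_dominated_convergence (μ := ν)
    (l := nhdsWithin (0 : ℝ) (Ioi 0)) (F := fun s (z : Euc d) => min s ‖z‖) (f := fun _ => 0)
    (fun z => min 1 ‖z‖) (Eventually.of_forall fun s => by fun_prop) ?_ hν
    (ae_of_all _ fun z => ?_)
  · simpa using h
  · filter_upwards [Ioo_mem_nhdsGT (zero_lt_one' ℝ)] with s hs
    refine ae_of_all _ fun z => ?_
    rw [Real.norm_of_nonneg (le_min hs.1.le (norm_nonneg z))]
    exact min_le_min_right _ hs.2.le
  · have hc : Continuous (fun s : ℝ => min s ‖z‖) := by fun_prop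
    have := (hc.tendsto 0).mono_left (nhdsWithin_le_nhds (s := Ioi 0))
    simpa using this

theorem integral_le_integral_of_le_of_measure_le {μ ν : Measure (Euc d)} (hμν : μ ≤ ν)
    {g G : Euc d → ℝ} (hg : Integrable g μ) (hgG : ∀ z, g z ≤ G z) (hG0 : ∀ z, 0 ≤ G z)
    (hG : Integrable G ν) : ∫ z, g z ∂μ ≤ ∫ z, G z ∂ν :=
  (integral_mono hg (hG.mono_measure hμν) hgG).trans
    (integral_mono_measure hμν (ae_of_all _ hG0) hG)

/-- The measures `μ x α β` are dominated by `ν` and any two of them differ, beyond a common part,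
by at most `C|x-y|ν`. -/
def LipschitzDominated (O : Set (Euc d)) (C : ℝ) (ν : Measure (Euc d))
    (μf : Euc d → A → B → Measure (Euc d)) : Prop :=
  ∀ x ∈ O, ∀ y ∈ O, ∀ (α : A) (β : B), ∃ m ρ ρ' : Measure (Euc d),
    μf x α β = m + ρ ∧ μf y α β = m + ρ' ∧ μf x α β ≤ ν ∧ μf y α β ≤ ν ∧
    ρ ≤ ENNReal.ofReal (C * ‖x - y‖) • ν ∧ ρ' ≤ ENNReal.ofReal (C * ‖x - y‖) • ν

theorem exists_decomposition_withDensity {ν₀ : Measure (Euc d)} [SigmaFinite ν₀]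
    {k : Euc d → ℝ≥0∞} (hk : Measurable k) {f₁ f₂ : Euc d → ℝ≥0∞} {κ : ℝ≥0∞}
    (h₁ : f₁ ≤ᵐ[ν₀] k) (h₂ : f₂ ≤ᵐ[ν₀] k)
    (h₁₂ : ∀ᵐ z ∂ν₀, f₁ z ≤ f₂ z + κ * k z) (h₂₁ : ∀ᵐ z ∂ν₀, f₂ z ≤ f₁ z + κ * k z) :
    ∃ m ρ ρ' : Measure (Euc d),
      ν₀.withDensity f₁ = m + ρ ∧ ν₀.withDensity f₂ = m + ρ' ∧
      ν₀.withDensity f₁ ≤ ν₀.withDensity k ∧ ν₀.withDensity f₂ ≤ ν₀.withDensity k ∧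
      ρ ≤ κ • ν₀.withDensity k ∧ ρ' ≤ κ • ν₀.withDensity k := by
  obtain ⟨g₁, hg₁, -, e₁⟩ := exists_measurable_le_withDensity_eq ν₀ f₁
  obtain ⟨g₂, hg₂, -, e₂⟩ := exists_measurable_le_withDensity_eq ν₀ f₂
  have key : ∀ {f f' g g' : Euc d → ℝ≥0∞}, Measurable g → Measurable g' →
      ν₀.withDensity g = ν₀.withDensity f → ν₀.withDensity g' = ν₀.withDensity f' →
      (∀ᵐ z ∂ν₀, f z ≤ f' z + κ * k z) →
      ν₀.withDensity g = ν₀.withDensity (fun z => min (g z) (g' z)) +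
        ν₀.withDensity (fun z => g z - g' z) ∧
      ν₀.withDensity (fun z => g z - g' z) ≤ κ • ν₀.withDensity k := by
    intro f f' g g' hg hg' e e' h
    have hae : g ≤ᵐ[ν₀] fun z => g' z + κ * k z := by
      refine ae_le_of_forall_setLIntegral_le_of_sigmaFinite hg fun s hs _ => ?_
      rw [lintegral_add_left hg', ← withDensity_apply _ hs, ← withDensity_apply _ hs, e, e',
        withDensity_apply _ hs, withDensity_apply _ hs,
        ← lintegral_add_right _ (hk.const_mul κ)]
      exact lintegral_mono_ae (ae_restrict_of_ae h)
    constructor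
    · rw [← withDensity_add_left (hg.min hg')]
      congr 1
      funext z
      simp only [Pi.add_apply]
      rw [add_comm, tsub_add_min]
    · rw [← withDensity_smul _ hk]
      refine withDensity_mono ?_
      filter_upwards [hae] with z hz
      exact tsub_le_iff_left.2 hz
  obtain ⟨a₁, b₁⟩ := key hg₁ hg₂ e₁ e₂ h₁₂
  obtain ⟨a₂, b₂⟩ := key hg₂ hg₁ e₂ e₁ h₂₁
  refine ⟨_, _, _, e₁ ▸ a₁, ?_, withDensity_mono h₁, withDensity_mono h₂, b₁, b₂⟩
  rw [← e₂, a₂]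
  simp only [min_comm]

theorem integrable_min_norm_withDensity_rpow [Nontrivial (Euc d)] {σ : ℝ} (hσ0 : 0 < σ)
    (hσ1 : σ < 1) (Λ₁ : ℝ) (hΛ : 0 ≤ Λ₁) :
    Integrable (fun z : Euc d => min 1 ‖z‖)
      (volume.withDensity fun z => ENNReal.ofReal (Λ₁ * ‖z‖ ^ (-((d : ℝ) + σ)))) := by
  rw [integrable_withDensity_iff_integrable_smul' (by fun_prop) (ae_of_all _ fun _ => by simp)]
  have h := (integrable_fun_norm_addHaar (volume : Measure (Euc d))
    (f := fun r => (Λ₁ * r ^ (-((d : ℝ) + σ))) * min 1 r)).2 ?_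
  · refine h.congr (ae_of_all _ fun z => ?_)
    simp only [smul_eq_mul]
    rw [ENNReal.toReal_ofReal (by positivity)]
  · have hd : Module.finrank ℝ (Euc d) = d := by simp
    have hdpos : 1 ≤ d := by
      rw [← hd]; exact Module.finrank_pos
    rw [hd]
    have hp : ∀ r : ℝ, 0 < r → r ^ (d - 1) * r ^ (-((d : ℝ) + σ)) = r ^ (-(1 + σ)) := by
      intro r hr
      rw [← Real.rpow_natCast, ← Real.rpow_add hr, Nat.cast_sub hdpos]
      congr 1
      push_cast
      ring
    rw [← Ioc_union_Ioi_eq_Ioi (zero_le_one' ℝ)]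
    refine IntegrableOn.union ?_ ?_
    · have h1 : IntegrableOn (fun r : ℝ => Λ₁ * r ^ (-σ)) (Ioc 0 1) := by
        refine Integrable.const_mul ?_ _
        have := (intervalIntegral.intervalIntegrable_rpow' (a := 0) (b := 1) (r := -σ)
          (by linarith))
        rwa [intervalIntegrable_iff_integrableOn_Ioc_of_le zero_le_one] at this
      refine h1.congr_fun (fun r hr => ?_) measurableSet_Ioc
      have hr0 : 0 < r := hr.1
      simp only [smul_eq_mul]
      rw [min_eq_right hr.2]
      calc Λ₁ * r ^ (-σ) = Λ₁ * (r ^ (-(1 + σ)) * r) := by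
            rw [← Real.rpow_add_one hr0.ne']; congr 2; ring
        _ = _ := by rw [← hp r hr0]; ring
    · have h1 : IntegrableOn (fun r : ℝ => Λ₁ * r ^ (-(1 + σ))) (Ioi 1) :=
        (integrableOn_Ioi_rpow_of_lt (by linarith) zero_lt_one).const_mul _
      refine h1.congr_fun (fun r hr => ?_) measurableSet_Ioi
      have hr0 : 0 < r := zero_lt_one.trans hr
      simp only [smul_eq_mul]
      rw [min_eq_left (le_of_lt hr), ← hp r hr0]
      ring

theorem lintegral_ofReal_min_norm {ν : Measure (Euc d)}
    (hν : Integrable (fun z : Euc d => min 1 ‖z‖) ν) :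
    ∫⁻ z, ENNReal.ofReal (min 1 ‖z‖) ∂ν = ENNReal.ofReal (∫ z, min 1 ‖z‖ ∂ν) :=
  (ofReal_integral_eq_lintegral_ofReal hν
    (ae_of_all _ fun z => le_min zero_le_one (norm_nonneg z))).symm

theorem measure_compl_ball_le_s1 {ν : Measure (Euc d)}
    (hν : Integrable (fun z : Euc d => min 1 ‖z‖) ν) :
    ν (ball (0 : Euc d) 1)ᶜ ≤ ENNReal.ofReal (∫ z, min 1 ‖z‖ ∂ν) := by
  rw [← lintegral_ofReal_min_norm hν, ← setLIntegral_one]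
  refine (setLIntegral_mono' measurableSet_ball.compl fun z hz => ?_).trans
    (setLIntegral_le_lintegral _ _)
  rw [mem_compl_iff, mem_ball_zero_iff, not_lt] at hz
  simp [min_eq_left hz]

theorem isModulus_mul_max {a : ℝ} (ha : 0 ≤ a) : IsModulus fun r => a * max r 0 := by
  refine ⟨fun r => by positivity, fun r s h => ?_, ?_⟩
  · exact mul_le_mul_of_nonneg_left (max_le_max_right _ h) ha
  · have hc : Continuous fun r : ℝ => a * max r 0 := by fun_prop
    have := (hc.tendsto 0).mono_left (nhdsWithin_le_nhds (s := Ioi 0))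
    simpa using this

theorem LipschitzDominated.assumptionB {O : Set (Euc d)} {C : ℝ} (hC : 0 ≤ C)
    {ν : Measure (Euc d)} {μf : Euc d → A → B → Measure (Euc d)}
    (h : LipschitzDominated O C ν μf) (hν : Integrable (fun z : Euc d => min 1 ‖z‖) ν) :
    AssumptionB O (fun x α β => (μf x α β).restrict (ball (0 : Euc d) 1)ᶜ) := by
  set N := ∫ z, min 1 ‖z‖ ∂ν with hN
  have hN0 : 0 ≤ N := integral_nonneg fun z => le_min zero_le_one (norm_nonneg z)
  refine ⟨fun r => (2 * (C * N)) * max r 0, isModulus_mul_max (by positivity), ?_⟩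
  intro x hx y hy α β
  obtain ⟨m, ρ, ρ', e, e', -, -, hρ, hρ'⟩ := h x hx y hy α β
  have key : ∀ {η : Measure (Euc d)}, η ≤ ENNReal.ofReal (C * ‖x - y‖) • ν →
      ∀ η' : Measure (Euc d),
      (⨆ (s : Set (Euc d)) (_ : MeasurableSet s), (m + η).restrict (ball (0 : Euc d) 1)ᶜ s -
        (m + η').restrict (ball (0 : Euc d) 1)ᶜ s) ≤ ENNReal.ofReal (C * N * ‖x - y‖) := by
    intro η hη η'
    refine iSup₂_le fun s hs => ?_
    rw [Measure.restrict_apply hs, Measure.restrict_apply hs, tsub_le_iff_left]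
    have h1 : η (s ∩ (ball (0 : Euc d) 1)ᶜ) ≤ ENNReal.ofReal (C * N * ‖x - y‖) := by
      calc η (s ∩ (ball (0 : Euc d) 1)ᶜ)
          ≤ ENNReal.ofReal (C * ‖x - y‖) * ν (ball (0 : Euc d) 1)ᶜ :=
            (measure_mono inter_subset_right).trans (hη _)
        _ ≤ ENNReal.ofReal (C * ‖x - y‖) * ENNReal.ofReal N := by
            gcongr; exact measure_compl_ball_le_s1 hν
        _ = _ := by
            rw [← ENNReal.ofReal_mul (by positivity)]; congr 1; ring
    simp only [Measure.coe_add, Pi.add_apply]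
    calc _ ≤ m (s ∩ (ball (0 : Euc d) 1)ᶜ) + ENNReal.ofReal (C * N * ‖x - y‖) := by gcongr
      _ ≤ _ := by gcongr; exact le_self_add
  have e0 : (2 * (C * N)) * max ‖x - y‖ 0 = C * N * ‖x - y‖ + C * N * ‖x - y‖ := by
    rw [max_eq_left (norm_nonneg _)]; ring
  show dTV ((μf x α β).restrict (ball (0 : Euc d) 1)ᶜ) ((μf y α β).restrict (ball (0 : Euc d) 1)ᶜ)
    ≤ ENNReal.ofReal ((2 * (C * N)) * max ‖x - y‖ 0)
  rw [e0, ENNReal.ofReal_add (by positivity) (by positivity), e, e']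
  exact add_le_add (key hρ ρ') (key hρ' ρ)

theorem LipschitzDominated.le {O : Set (Euc d)} {C : ℝ}
    {ν : Measure (Euc d)} {μf : Euc d → A → B → Measure (Euc d)}
    (h : LipschitzDominated O C ν μf) {x : Euc d} (hx : x ∈ O) (α : A) (β : B) :
    μf x α β ≤ ν := by
  obtain ⟨m, ρ, ρ', -, -, hle, -⟩ := h x hx x hx α β
  exact hle

theorem LipschitzDominated.assumptionE {O : Set (Euc d)} {C : ℝ}
    {ν : Measure (Euc d)} {μf : Euc d → A → B → Measure (Euc d)}
    (h : LipschitzDominated O C ν μf) (hν : Integrable (fun z : Euc d => min 1 ‖z‖) ν) :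
    AssumptionE O 1 μf := by
  have hN0 : 0 ≤ ∫ z, min 1 ‖z‖ ∂ν := integral_nonneg fun z => le_min zero_le_one (norm_nonneg z)
  constructor
  · set η : Measure (Euc d) := ν.withDensity fun z => ENNReal.ofReal ‖z‖ with hη
    have hball : ∀ r, η (ball (0 : Euc d) r) = ∫⁻ z in ball (0 : Euc d) r, ENNReal.ofReal ‖z‖ ∂ν :=
      fun r => withDensity_apply _ measurableSet_ball
    have hfin : ∀ r, η (ball (0 : Euc d) r) ≠ ⊤ := by
      intro r
      rw [hball]
      refine ne_top_of_le_ne_top (b := ENNReal.ofReal (max 1 r) *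
        ENNReal.ofReal (∫ z, min 1 ‖z‖ ∂ν)) (by finiteness) ?_
      rw [← lintegral_ofReal_min_norm hν, ← lintegral_const_mul _ (by fun_prop)]
      refine (setLIntegral_mono' measurableSet_ball fun z hz => ?_).trans
        (setLIntegral_le_lintegral _ _)
      rw [mem_ball_zero_iff] at hz
      rw [← ENNReal.ofReal_mul (by positivity)]
      refine ENNReal.ofReal_le_ofReal ?_
      rcases le_total ‖z‖ 1 with h1 | h1
      · rw [min_eq_right h1]
        nlinarith [norm_nonneg z, le_max_left 1 r]
      · rw [min_eq_left h1, mul_one]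
        exact hz.le.trans (le_max_right _ _)
    refine ⟨fun r => (η (ball (0 : Euc d) r)).toReal, ⟨fun r => ENNReal.toReal_nonneg,
      fun r s hrs => ENNReal.toReal_mono (hfin s) (measure_mono (ball_subset_ball hrs)), ?_⟩, ?_⟩
    · have ht := tendsto_measure_biInter_gt (μ := η) (s := fun r : ℝ => ball (0 : Euc d) r) (a := 0)
        (fun r _ => measurableSet_ball.nullMeasurableSet)
        (fun i j _ hij => ball_subset_ball hij) ⟨1, zero_lt_one, hfin 1⟩
      have h0 : (⋂ r, ⋂ (_ : r > (0 : ℝ)), ball (0 : Euc d) r) = {0} := by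
        ext z
        simp only [mem_iInter, mem_ball_zero_iff, mem_singleton_iff]
        constructor
        · intro hz
          by_contra hne
          exact lt_irrefl _ (hz ‖z‖ (norm_pos_iff.2 hne))
        · rintro rfl r hr
          simpa using hr
      have hz : η {0} = 0 := by
        rw [hη, withDensity_apply _ (measurableSet_singleton 0)]
        simp
      rw [h0, hz] at ht
      have := (ENNReal.tendsto_toReal (ENNReal.zero_ne_top)).comp ht
      simpa [Function.comp_def] using this
    · intro r _ x hx α β
      rw [ENNReal.ofReal_toReal (hfin r), hball]
      simp only [Real.rpow_one]
      exact lintegral_mono' (Measure.restrict_mono le_rfl (h.le hx α β)) le_rfl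
  · refine ⟨_, hN0, fun x hx α β => ?_⟩
    rw [← lintegral_ofReal_min_norm hν]
    simp only [Real.rpow_one]
    exact lintegral_mono' (h.le hx α β) le_rfl

/-- The plan keeping a common part of two measures in place and moving the rest to the origin
costs the first moment of the rest. -/
theorem dLpPow_one_le_of_decomposition {m ρ ρ' : Measure (Euc d)} (hm : m {0} = 0)
    (hρ : ρ {0} = 0) (hρ' : ρ' {0} = 0) :
    dLpPow 1 (m + ρ) (m + ρ') ≤
      ∫⁻ z, ENNReal.ofReal ‖z‖ ∂ρ + ∫⁻ z, ENNReal.ofReal ‖z‖ ∂ρ' := by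
  have m1 : Measurable fun z : Euc d => (z, z) := by fun_prop
  have m2 : Measurable fun z : Euc d => (z, (0 : Euc d)) := by fun_prop
  have m3 : Measurable fun z : Euc d => ((0 : Euc d), z) := by fun_prop
  set γ : Measure (Euc d × Euc d) :=
    m.map (fun z => (z, z)) + ρ.map (fun z => (z, 0)) + ρ'.map (fun z => (0, z)) with hγ
  have hadm : γ ∈ AdmPlan (m + ρ) (m + ρ') := by
    refine ⟨?_, ?_, ?_⟩
    · have hs : MeasurableSet {((0 : Euc d), (0 : Euc d))} := measurableSet_singleton _
      have p1 : (fun z : Euc d => (z, z)) ⁻¹' {((0 : Euc d), (0 : Euc d))} = {0} := by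
        ext z; simp
      have p2 : (fun z : Euc d => (z, (0 : Euc d))) ⁻¹' {((0 : Euc d), (0 : Euc d))} = {0} := by
        ext z; simp
      have p3 : (fun z : Euc d => ((0 : Euc d), z)) ⁻¹' {((0 : Euc d), (0 : Euc d))} = {0} := by
        ext z; simp
      simp only [hγ, Measure.coe_add, Pi.add_apply]
      rw [Measure.map_apply m1 hs, Measure.map_apply m2 hs, Measure.map_apply m3 hs, p1, p2, p3,
        hm, hρ, hρ']
      simp
    · rw [hγ, Measure.map_add _ _ measurable_fst, Measure.map_add _ _ measurable_fst,
        Measure.map_map measurable_fst m1, Measure.map_map measurable_fst m2,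
        Measure.map_map measurable_fst m3]
      ext s hs
      rw [Measure.restrict_apply hs]
      have hs' := hs.inter (measurableSet_singleton (0 : Euc d)).compl
      simp only [Measure.coe_add, Pi.add_apply]
      rw [Measure.map_apply (by fun_prop) hs', Measure.map_apply (by fun_prop) hs',
        Measure.map_apply (by fun_prop) hs']
      have q : ∀ η : Measure (Euc d), η {0} = 0 → η (s ∩ {0}ᶜ) = η s := fun η h0 =>
        measure_inter_conull (by simpa using h0)
      have q1 : (Prod.fst ∘ fun z : Euc d => (z, z)) ⁻¹' (s ∩ {0}ᶜ) = s ∩ {0}ᶜ := rfl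
      have q2 : (Prod.fst ∘ fun z : Euc d => (z, (0 : Euc d))) ⁻¹' (s ∩ {0}ᶜ) = s ∩ {0}ᶜ := rfl
      have q3 : (Prod.fst ∘ fun z : Euc d => ((0 : Euc d), z)) ⁻¹' (s ∩ {0}ᶜ) = ∅ := by
        ext z; simp
      rw [q1, q2, q3, q m hm, q ρ hρ]
      simp
    · rw [hγ, Measure.map_add _ _ measurable_snd, Measure.map_add _ _ measurable_snd,
        Measure.map_map measurable_snd m1, Measure.map_map measurable_snd m2,
        Measure.map_map measurable_snd m3]
      ext s hs
      rw [Measure.restrict_apply hs]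
      have hs' := hs.inter (measurableSet_singleton (0 : Euc d)).compl
      simp only [Measure.coe_add, Pi.add_apply]
      rw [Measure.map_apply (by fun_prop) hs', Measure.map_apply (by fun_prop) hs',
        Measure.map_apply (by fun_prop) hs']
      have q : ∀ η : Measure (Euc d), η {0} = 0 → η (s ∩ {0}ᶜ) = η s := fun η h0 =>
        measure_inter_conull (by simpa using h0)
      have q1 : (Prod.snd ∘ fun z : Euc d => (z, z)) ⁻¹' (s ∩ {0}ᶜ) = s ∩ {0}ᶜ := rfl
      have q2 : (Prod.snd ∘ fun z : Euc d => (z, (0 : Euc d))) ⁻¹' (s ∩ {0}ᶜ) = ∅ := by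
        ext z; simp
      have q3 : (Prod.snd ∘ fun z : Euc d => ((0 : Euc d), z)) ⁻¹' (s ∩ {0}ᶜ) = s ∩ {0}ᶜ := rfl
      rw [q1, q2, q3, q m hm, q ρ' hρ']
      simp
  refine (iInf₂_le γ hadm).trans (le_of_eq ?_)
  have hmeas : Measurable fun q : Euc d × Euc d => ENNReal.ofReal (‖q.1 - q.2‖ ^ (1 : ℝ)) := by
    fun_prop
  rw [Jp, hγ, lintegral_add_measure, lintegral_add_measure, lintegral_map hmeas m1,
    lintegral_map hmeas m2, lintegral_map hmeas m3]
  simp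

theorem LipschitzDominated.assumptionA {O : Set (Euc d)} {C : ℝ} (hC : 0 ≤ C)
    {ν : Measure (Euc d)} {μf : Euc d → A → B → Measure (Euc d)}
    (h : LipschitzDominated O C ν μf) (hν : Integrable (fun z : Euc d => min 1 ‖z‖) ν)
    (hν0 : ν {0} = 0) :
    AssumptionA O 1 (fun x α β => (μf x α β).restrict (ball (0 : Euc d) 1)) := by
  set N := ∫ z, min 1 ‖z‖ ∂ν with hN
  have hN0 : 0 ≤ N := integral_nonneg fun z => le_min zero_le_one (norm_nonneg z)
  refine ⟨2 * (C * N), by positivity, ?_⟩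
  intro x hx y hy α β
  obtain ⟨m, ρ, ρ', e, e', hle, hle', hρ, hρ'⟩ := h x hx y hy α β
  have z0 : ∀ {η : Measure (Euc d)}, η ≤ ν → η.restrict (ball (0 : Euc d) 1) {0} = 0 := by
    intro η hη
    exact le_antisymm ((Measure.restrict_apply_le _ _).trans ((hη _).trans hν0.le)) zero_le
  have key : ∀ {η : Measure (Euc d)}, η ≤ ENNReal.ofReal (C * ‖x - y‖) • ν →
      ∫⁻ z, ENNReal.ofReal ‖z‖ ∂(η.restrict (ball (0 : Euc d) 1)) ≤
        ENNReal.ofReal (C * N * ‖x - y‖) := by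
    intro η hη
    calc ∫⁻ z, ENNReal.ofReal ‖z‖ ∂(η.restrict (ball (0 : Euc d) 1))
        ≤ ∫⁻ z in ball (0 : Euc d) 1, ENNReal.ofReal (min 1 ‖z‖) ∂η := by
          refine setLIntegral_mono' measurableSet_ball fun z hz => ?_
          rw [mem_ball_zero_iff] at hz
          rw [min_eq_right hz.le]
      _ ≤ ∫⁻ z, ENNReal.ofReal (min 1 ‖z‖) ∂(ENNReal.ofReal (C * ‖x - y‖) • ν) :=
          (setLIntegral_le_lintegral _ _).trans (lintegral_mono' hη le_rfl)
      _ = _ := by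
          rw [lintegral_smul_measure, lintegral_ofReal_min_norm hν, smul_eq_mul,
            ← ENNReal.ofReal_mul (by positivity)]
          congr 1; ring
  have hmν : m ≤ ν := (Measure.le_add_right le_rfl).trans (e ▸ hle)
  have hρν : ρ ≤ ν := (Measure.le_add_left le_rfl).trans (e ▸ hle)
  have hρν' : ρ' ≤ ν := (Measure.le_add_left le_rfl).trans (e' ▸ hle')
  have hd : dLpPow 1 ((μf x α β).restrict (ball (0 : Euc d) 1))
      ((μf y α β).restrict (ball (0 : Euc d) 1)) ≤
      ENNReal.ofReal (2 * (C * N) * ‖x - y‖) := by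
    rw [e, e', Measure.restrict_add, Measure.restrict_add]
    refine (dLpPow_one_le_of_decomposition (z0 hmν) (z0 hρν) (z0 hρν')).trans
      ((add_le_add (key hρ) (key hρ')).trans (le_of_eq ?_))
    rw [← ENNReal.ofReal_add (by positivity) (by positivity)]
    congr 1; ring
  rw [dLp, div_one, Real.rpow_one]
  exact ENNReal.toReal_le_of_le_ofReal (by positivity) hd

theorem assumptionA_of_subsingleton [Subsingleton (Euc d)] (O : Set (Euc d))
    (νhat : Euc d → A → B → Measure (Euc d)) : AssumptionA O 1 νhat := by
  refine ⟨0, le_rfl, fun x _ y _ α β => ?_⟩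
  rw [dLp, div_one, Real.rpow_one, zero_mul]
  rcases (AdmPlan (νhat x α β) (νhat y α β)).eq_empty_or_nonempty with h | ⟨γ, hγ⟩
  · simp [dLpPow, h]
  · have h0 : dLpPow 1 (νhat x α β) (νhat y α β) = 0 := by
      refine le_antisymm ((iInf₂_le γ hγ).trans (le_of_eq ?_)) zero_le
      have hz : ∀ z : Euc d, ‖z‖ = 0 := fun z => by rw [Subsingleton.elim z 0, norm_zero]
      simp [Jp, hz]
    simp [h0]

/-- A test function touching `u` from above at `x` may be replaced by one with the same germ at `x`
that is close to `u` away from `x`. -/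
theorem exists_test_close {u φ : Euc d → ℝ} (hu : Continuous u) (hub : ∃ M, ∀ y, |u y| ≤ M)
    (hφ : ContDiff ℝ 2 φ) (hφb : ∃ M, ∀ y, |φ y| ≤ M) (huφ : ∀ y, u y ≤ φ y) (x : Euc d)
    {δ : ℝ} (hδ : 0 < δ) :
    ∃ ψ : Euc d → ℝ, ContDiff ℝ 2 ψ ∧ (∃ M, ∀ y, |ψ y| ≤ M) ∧ (∀ y, u y ≤ ψ y) ∧
      ψ =ᶠ[nhds x] φ ∧ (∀ z, ψ (x + z) ≤ φ (x + z) + min δ ‖z‖) ∧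
      ∀ z, 2 * δ ≤ ‖z‖ → ψ (x + z) ≤ u (x + z) + δ := by
  obtain ⟨g, hg, hga, -⟩ := (Continuous.exists_contDiff_approx (f := fun y => u y + δ / 2) 2
    (by fun_prop) (ε := fun _ => δ / 2) continuous_const (fun _ => by positivity))
  have hg1 : ∀ y, u y ≤ g y := fun y => by
    have := (abs_lt.1 (Real.dist_eq _ _ ▸ hga y)).1
    linarith
  have hg2 : ∀ y, g y ≤ u y + δ := fun y => by
    have := (abs_lt.1 (Real.dist_eq _ _ ▸ hga y)).2
    linarith
  let χ : ContDiffBump x := ⟨δ, 2 * δ, hδ, by linarith⟩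
  have hχ0 : ∀ y, 0 ≤ χ y := fun y => χ.nonneg
  have hχ1 : ∀ y, χ y ≤ 1 := fun y => χ.le_one
  have hlow : ∀ y, u y ≤ χ y * φ y + (1 - χ y) * g y := fun y => by
    nlinarith [hχ0 y, hχ1 y, huφ y, hg1 y]
  obtain ⟨M, hM⟩ := hub
  obtain ⟨M', hM'⟩ := hφb
  refine ⟨fun y => χ y * φ y + (1 - χ y) * g y, ?_, ⟨M + M' + δ, fun y => ?_⟩, hlow, ?_, ?_, ?_⟩
  · have h1 : ContDiff ℝ 2 χ := χ.contDiff
    have h2 : ContDiff ℝ 2 g := by exact_mod_cast hg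
    exact (h1.mul hφ).add ((contDiff_const.sub h1).mul h2)
  · have a1 := abs_le.1 (hM y)
    have a2 := abs_le.1 (hM' y)
    have a3 := hlow y
    rw [abs_le]
    constructor
    · linarith
    · nlinarith [hχ0 y, hχ1 y, hg2 y]
  · filter_upwards [χ.eventuallyEq_one] with y hy
    simp only [Pi.one_apply] at hy
    simp [hy]
  · intro z
    rcases le_total ‖z‖ δ with hz | hz
    · have : χ (x + z) = 1 := χ.one_of_mem_closedBall (by simpa [mem_closedBall, dist_eq_norm])
      simp only [this]
      have : 0 ≤ min δ ‖z‖ := le_min hδ.le (norm_nonneg z)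
      linarith
    · rw [min_eq_left hz]
      nlinarith [hχ0 (x + z), hχ1 (x + z), hg2 (x + z), huφ (x + z)]
  · intro z hz
    have : χ (x + z) = 0 := χ.zero_of_le_dist (by simpa [dist_eq_norm])
    simp only [this]
    linarith [hg2 (x + z)]

section Isaacs

variable {O : Set (Euc d)} {ν : Measure (Euc d)} {μf : Euc d → A → B → Measure (Euc d)}
  {c f : A → B → Euc d → ℝ}

theorem exists_abs_isaacs_le (hν : Integrable (fun z : Euc d => min 1 ‖z‖) ν)
    (hμ : ∀ x ∈ O, ∀ (α : A) (β : B), μf x α β ≤ ν)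
    (hf : AssumptionC O f) (hc : AssumptionD O c) {φ : Euc d → ℝ} (hφ : ContDiff ℝ 2 φ)
    (hφb : ∃ M, ∀ y, |φ y| ≤ M) {x : Euc d} (hx : x ∈ O) :
    ∃ K, ∀ α β, |-(Lop (μf x α β) φ x) + c α β x * φ x + f α β x| ≤ K := by
  obtain ⟨L, hL0, hL⟩ := exists_abs_levyIncrement_le hφ hφb x
  obtain ⟨-, -, Cf, -, -, hCf⟩ := hf
  obtain ⟨lam, lam1, hlam, -, hc1, -⟩ := hc
  refine ⟨L * ∫ z, min 1 ‖z‖ ∂ν + lam1 * |φ x| + Cf, fun α β => ?_⟩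
  have hLop : |Lop (μf x α β) φ x| ≤ L * ∫ z, min 1 ‖z‖ ∂ν := by
    have h1 : ‖∫ z, levyIncrement φ x z ∂(μf x α β)‖ ≤ ∫ z, L * min 1 ‖z‖ ∂(μf x α β) :=
      norm_integral_le_of_norm_le ((hν.mono_measure (hμ x hx α β)).const_mul L)
        (ae_of_all _ hL)
    refine h1.trans ?_
    rw [integral_const_mul]
    refine mul_le_mul_of_nonneg_left (integral_mono_measure (hμ x hx α β)
      (ae_of_all _ fun z => ?_) hν) hL0
    exact le_min zero_le_one (norm_nonneg z)
  have hcφ : |c α β x * φ x| ≤ lam1 * |φ x| := by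
    obtain ⟨h1, h2⟩ := hc1 x hx α β
    rw [abs_mul, abs_of_nonneg (hlam.le.trans h1)]
    exact mul_le_mul_of_nonneg_right h2 (abs_nonneg _)
  calc _ ≤ |-(Lop (μf x α β) φ x) + c α β x * φ x| + |f α β x| := abs_add_le _ _
    _ ≤ |-(Lop (μf x α β) φ x)| + |c α β x * φ x| + |f α β x| := by
        gcongr; exact abs_add_le _ _
    _ ≤ _ := by
        rw [abs_neg]
        linarith [hCf x hx α β]

theorem exists_lt_of_iop_nonpos [Nonempty A] [Nonempty B] {φ : Euc d → ℝ} {x : Euc d}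
    (hK : ∃ K, ∀ α β, |-(Lop (μf x α β) φ x) + c α β x * φ x + f α β x| ≤ K)
    (h : Iop μf c f φ x ≤ 0) {τ : ℝ} (hτ : 0 < τ) (α : A) :
    ∃ β, -(Lop (μf x α β) φ x) + c α β x * φ x + f α β x < τ := by
  obtain ⟨K, hK⟩ := hK
  refine exists_lt_of_ciInf_lt (lt_of_le_of_lt (le_ciSup (f := fun α => ⨅ β : B,
    (-(Lop (μf x α β) φ x) + c α β x * φ x + f α β x)) ⟨K, ?_⟩ α) (lt_of_le_of_lt h hτ))
  rintro _ ⟨α', rfl⟩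
  obtain ⟨β⟩ := ‹Nonempty B›
  refine (ciInf_le ⟨-K, ?_⟩ β).trans (abs_le.1 (hK α' β)).2
  rintro _ ⟨β', rfl⟩
  exact (abs_le.1 (hK α' β')).1

theorem exists_forall_lt_of_iop_nonneg [Nonempty A] {φ : Euc d → ℝ} {x : Euc d}
    (hK : ∃ K, ∀ α β, |-(Lop (μf x α β) φ x) + c α β x * φ x + f α β x| ≤ K)
    (h : 0 ≤ Iop μf c f φ x) {τ : ℝ} (hτ : 0 < τ) :
    ∃ α, ∀ β, -τ < -(Lop (μf x α β) φ x) + c α β x * φ x + f α β x := by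
  obtain ⟨K, hK⟩ := hK
  have h' : -τ < Iop μf c f φ x := by linarith
  obtain ⟨α, hα⟩ := exists_lt_of_lt_ciSup h'
  refine ⟨α, fun β => hα.trans_le (ciInf_le ⟨-K, ?_⟩ β)⟩
  rintro _ ⟨β', rfl⟩
  exact (abs_le.1 (hK α β')).1

end Isaacs

/-- The bounded smooth penalization `|w|² / (1 + |w|²)`. -/
def saturatedSq (w : Euc d) : ℝ := ‖w‖ ^ 2 / (1 + ‖w‖ ^ 2)

theorem saturatedSq_nonneg (w : Euc d) : 0 ≤ saturatedSq w := by
  unfold saturatedSq; positivity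

theorem saturatedSq_le_one (w : Euc d) : saturatedSq w ≤ 1 := by
  unfold saturatedSq
  rw [div_le_one (by positivity)]
  linarith

@[simp] theorem saturatedSq_zero : saturatedSq (0 : Euc d) = 0 := by simp [saturatedSq]

theorem contDiff_saturatedSq : ContDiff ℝ 2 (saturatedSq : Euc d → ℝ) := by
  unfold saturatedSq
  exact (contDiff_norm_sq ℝ).div (contDiff_const.add (contDiff_norm_sq ℝ))
    fun w => by positivity

theorem abs_saturatedSq_sub_le (w z : Euc d) :
    |saturatedSq (w + z) - saturatedSq w| ≤ ‖z‖ * (2 * ‖w‖ + ‖z‖) := by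
  have h1 : ‖w + z‖ ≤ ‖w‖ + ‖z‖ := norm_add_le _ _
  have h2 : ‖w‖ ≤ ‖w + z‖ + ‖z‖ := norm_le_add_norm_add w z
  have e : saturatedSq (w + z) - saturatedSq w =
      (‖w + z‖ ^ 2 - ‖w‖ ^ 2) / ((1 + ‖w + z‖ ^ 2) * (1 + ‖w‖ ^ 2)) := by
    unfold saturatedSq
    field_simp
    ring
  rw [e, abs_div, abs_of_pos (a := (1 + ‖w + z‖ ^ 2) * (1 + ‖w‖ ^ 2)) (by positivity),
    div_le_iff₀ (by positivity)]
  have h3 : |‖w + z‖ ^ 2 - ‖w‖ ^ 2| ≤ ‖z‖ * (2 * ‖w‖ + ‖z‖) := by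
    rw [abs_le]
    constructor <;> nlinarith [norm_nonneg w, norm_nonneg z, norm_nonneg (w + z)]
  refine h3.trans (le_mul_of_one_le_right (by positivity) ?_)
  nlinarith [sq_nonneg ‖w + z‖, sq_nonneg ‖w‖, mul_nonneg (sq_nonneg ‖w + z‖) (sq_nonneg ‖w‖)]

theorem norm_fderiv_saturatedSq_le {w : Euc d} {s : ℝ} (hs : 0 < s) (hw : ‖w‖ ≤ s) :
    ‖fderiv ℝ saturatedSq w‖ ≤ 3 * s := by
  have hd : HasFDerivAt saturatedSq (fderiv ℝ saturatedSq w) w :=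
    (contDiff_saturatedSq.differentiable (by norm_num)).differentiableAt.hasFDerivAt
  refine hd.le_of_lip' (by positivity) ?_
  filter_upwards [closedBall_mem_nhds w hs] with y hy
  rw [mem_closedBall, dist_eq_norm] at hy
  have := abs_saturatedSq_sub_le w (y - w)
  rw [add_sub_cancel] at this
  rw [Real.norm_eq_abs]
  nlinarith [norm_nonneg (y - w)]

theorem sq_norm_le_of_saturatedSq_le {w : Euc d} {t : ℝ} (h : saturatedSq w ≤ t)
    (ht : t ≤ 1 / 2) : ‖w‖ ^ 2 ≤ 2 * t := by
  unfold saturatedSq at h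
  rw [div_le_iff₀ (by positivity)] at h
  nlinarith [sq_nonneg ‖w‖]

theorem integral_sub_integral_le_of_decomposition {ν μ μ' m ρ ρ' : Measure (Euc d)} {κ : ℝ}
    (hκ : 0 ≤ κ) (e : μ = m + ρ) (e' : μ' = m + ρ') (hμ : μ ≤ ν) (hμ' : μ' ≤ ν)
    (hρ : ρ ≤ ENNReal.ofReal κ • ν) (hρ' : ρ' ≤ ENNReal.ofReal κ • ν)
    {a b G₀ G₁ : Euc d → ℝ} (ha : Integrable a ν) (hb : Integrable b ν)
    (hG₀ : Integrable G₀ ν) (hG₁ : Integrable G₁ ν) (hG₀0 : ∀ z, 0 ≤ G₀ z)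
    (hG₁0 : ∀ z, 0 ≤ G₁ z) (hab : ∀ z, a z - b z ≤ G₀ z) (haG : ∀ z, a z ≤ G₁ z)
    (hbG : ∀ z, -b z ≤ G₁ z) :
    ∫ z, a z ∂μ - ∫ z, b z ∂μ' ≤ ∫ z, G₀ z ∂ν + 2 * (κ * ∫ z, G₁ z ∂ν) := by
  have hmν : m ≤ ν := (Measure.le_add_right le_rfl).trans (e ▸ hμ)
  have hρν : ρ ≤ ν := (Measure.le_add_left le_rfl).trans (e ▸ hμ)
  have hρν' : ρ' ≤ ν := (Measure.le_add_left le_rfl).trans (e' ▸ hμ')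
  have h0 : ∫ z, (a z - b z) ∂m ≤ ∫ z, G₀ z ∂ν :=
    integral_le_integral_of_le_of_measure_le hmν
      ((ha.mono_measure hmν).sub (hb.mono_measure hmν)) hab hG₀0 hG₀
  have h1 : ∀ {η : Measure (Euc d)} {g : Euc d → ℝ}, η ≤ ν → η ≤ ENNReal.ofReal κ • ν →
      Integrable g ν → (∀ z, g z ≤ G₁ z) → ∫ z, g z ∂η ≤ κ * ∫ z, G₁ z ∂ν := by
    intro η g hην hη hg hgG
    have := integral_le_integral_of_le_of_measure_le hη (hg.mono_measure hην) hgG hG₁0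
      (hG₁.smul_measure ENNReal.ofReal_ne_top)
    rwa [integral_smul_measure, ENNReal.toReal_ofReal hκ, smul_eq_mul] at this
  have h2 := h1 hρν hρ ha haG
  have h3 := h1 hρν' hρ' hb.neg hbG
  simp only [Pi.neg_apply] at h3
  rw [integral_neg] at h3
  rw [integral_sub (ha.mono_measure hmν) (hb.mono_measure hmν)] at h0
  rw [e, e', integral_add_measure (ha.mono_measure hmν) (ha.mono_measure hρν),
    integral_add_measure (hb.mono_measure hmν) (hb.mono_measure hρν')]
  linarith

/-- Test functions at a maximum point of the doubled functional, with one-sided bounds on their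
increments. -/
theorem exists_test_pair {u v : Euc d → ℝ} (hu : Continuous u) (hv : Continuous v) {Mb : ℝ}
    (huM : ∀ x, |u x| ≤ Mb) (hvM : ∀ x, |v x| ≤ Mb) {k s δ : ℝ} (hk : 0 < k) (hδ : 0 < δ)
    (hδs : 2 * δ ≤ s) {x y : Euc d} (hxy : ‖x - y‖ ≤ s)
    (hmax : ∀ x' y', u x' - v y' - k * saturatedSq (x' - y') ≤
      u x - v y - k * saturatedSq (x - y)) :
    ∃ φ ψ : Euc d → ℝ,
      (ContDiff ℝ 2 φ ∧ (∃ M, ∀ x', |φ x'| ≤ M) ∧ φ x = u x ∧ ∀ x', u x' ≤ φ x') ∧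
      (ContDiff ℝ 2 ψ ∧ (∃ M, ∀ x', |ψ x'| ≤ M) ∧ ψ y = v y ∧ ∀ x', ψ x' ≤ v x') ∧
      (∀ z, levyIncrement φ x z - levyIncrement ψ y z ≤ (6 * s * k + 2) * min (2 * δ) ‖z‖) ∧
      (∀ z, levyIncrement φ x z ≤
        (3 * s * k + 2 * Mb / s + 1) * min s ‖z‖ + 3 * s * k * min 1 ‖z‖) ∧
      (∀ z, -levyIncrement ψ y z ≤
        (3 * s * k + 2 * Mb / s + 1) * min s ‖z‖ + 3 * s * k * min 1 ‖z‖) := by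
  have hs : 0 < s := by linarith
  have hMb : 0 ≤ Mb := (abs_nonneg _).trans (huM 0)
  set w := x - y with hw
  set P : Euc d →L[ℝ] ℝ := k • fderiv ℝ saturatedSq w with hP
  have hPle : ‖P‖ ≤ 3 * s * k := by
    rw [hP, norm_smul, Real.norm_of_nonneg hk.le]
    nlinarith [norm_fderiv_saturatedSq_le hs hxy]
  have hqd : ∀ w' : Euc d, HasFDerivAt saturatedSq (fderiv ℝ saturatedSq w') w' := fun w' =>
    (contDiff_saturatedSq.differentiable (by norm_num)).differentiableAt.hasFDerivAt
  let φ₀ : Euc d → ℝ := fun x' => u x + k * (saturatedSq (x' - y) - saturatedSq w)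
  let ψ₀ : Euc d → ℝ := fun y' => -v y + k * (saturatedSq (x - y') - saturatedSq w)
  have bdd : ∀ (t : ℝ) (g : Euc d → Euc d),
      ∃ M, ∀ x', |t + k * (saturatedSq (g x') - saturatedSq w)| ≤ M := by
    intro t g
    refine ⟨|t| + k * 1, fun x' => (abs_add_le _ _).trans ?_⟩
    rw [abs_mul, abs_of_pos hk]
    gcongr
    rw [abs_le]
    constructor <;> linarith [saturatedSq_nonneg (g x'), saturatedSq_nonneg w,
      saturatedSq_le_one (g x'), saturatedSq_le_one w]
  have hφ₀ : ContDiff ℝ 2 φ₀ := contDiff_const.add (contDiff_const.mul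
    ((contDiff_saturatedSq.comp (contDiff_id.sub contDiff_const)).sub contDiff_const))
  have hψ₀ : ContDiff ℝ 2 ψ₀ := contDiff_const.add (contDiff_const.mul
    ((contDiff_saturatedSq.comp (contDiff_const.sub contDiff_id)).sub contDiff_const))
  have hφ₀' : fderiv ℝ φ₀ x = P := by
    refine HasFDerivAt.fderiv ?_
    have h1 : HasFDerivAt (fun x' : Euc d => x' - y) (ContinuousLinearMap.id ℝ (Euc d)) x :=
      (hasFDerivAt_id x).sub_const y
    have h2 := ((((hqd w).comp x h1).sub_const (saturatedSq w)).const_mul k).const_add (u x)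
    exact h2.congr_fderiv (by ext; simp [hP])
  have hψ₀' : fderiv ℝ ψ₀ y = -P := by
    refine HasFDerivAt.fderiv ?_
    have h1 : HasFDerivAt (fun y' : Euc d => x - y') (-ContinuousLinearMap.id ℝ (Euc d)) y :=
      (hasFDerivAt_id y).const_sub x
    have h2 := ((((hqd w).comp y h1).sub_const (saturatedSq w)).const_mul k).const_add (-v y)
    exact h2.congr_fderiv (by ext; simp [hP])
  have huφ : ∀ x', u x' ≤ φ₀ x' := fun x' => by
    have := hmax x' y
    simp only [φ₀]; linarith
  have hvψ : ∀ y', -v y' ≤ ψ₀ y' := fun y' => by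
    have := hmax x y'
    simp only [ψ₀]; linarith
  obtain ⟨φ, hφ, hφb, hφu, hφe, hφ1, hφ2⟩ :=
    exists_test_close hu ⟨Mb, huM⟩ hφ₀ (bdd _ _) huφ x hδ
  obtain ⟨ψ, hψ, hψb, hψv, hψe, hψ1, hψ2⟩ :=
    exists_test_close (u := fun y' => -v y') hv.neg ⟨Mb, fun y' => by rw [abs_neg]; exact hvM y'⟩
      hψ₀ (bdd _ _) hvψ y hδ
  have hφx : φ x = u x := by rw [hφe.eq_of_nhds]; simp [φ₀, hw]
  have hψy : ψ y = -v y := by rw [hψe.eq_of_nhds]; simp [ψ₀, hw]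
  have hIφ : ∀ z, levyIncrement φ x z = φ (x + z) - u x -
      (ball (0 : Euc d) 1).indicator (fun w => P w) z := fun z => by
    rw [levyIncrement, hφe.fderiv_eq, hφ₀', hφx]
  have hIψ : ∀ z, -levyIncrement (fun y' => -ψ y') y z = ψ (y + z) + v y +
      (ball (0 : Euc d) 1).indicator (fun w => P w) z := fun z => by
    rw [levyIncrement, fderiv_fun_neg, hψe.fderiv_eq, hψ₀', hψy]
    simp only [neg_neg]
    ring
  have hP1 : ∀ z, |(ball (0 : Euc d) 1).indicator (fun w => P w) z| ≤
      3 * s * k * min 1 ‖z‖ := fun z =>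
    (abs_indicator_ball_apply_le P z).trans
      (mul_le_mul_of_nonneg_right hPle (le_min zero_le_one (norm_nonneg z)))
  have hnear : ∀ z : Euc d, ‖z‖ ≤ s → φ (x + z) - u x ≤ 3 * s * k * ‖z‖ + min δ ‖z‖ ∧
      ψ (y + z) + v y ≤ 3 * s * k * ‖z‖ + min δ ‖z‖ := by
    intro z hz
    have hb : ‖z‖ * (2 * ‖w‖ + ‖z‖) ≤ 3 * s * ‖z‖ := by nlinarith [norm_nonneg z]
    have e1 : saturatedSq (x + z - y) - saturatedSq w ≤ 3 * s * ‖z‖ := by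
      have := (le_abs_self _).trans (abs_saturatedSq_sub_le w z)
      rw [show w + z = x + z - y by rw [hw]; abel] at this
      linarith
    have e2 : saturatedSq (x - (y + z)) - saturatedSq w ≤ 3 * s * ‖z‖ := by
      have := (le_abs_self _).trans (abs_saturatedSq_sub_le w (-z))
      rw [show w + -z = x - (y + z) by rw [hw]; abel, norm_neg] at this
      linarith
    have h1 := hφ1 z
    have h2 := hψ1 z
    simp only [φ₀, ψ₀] at h1 h2
    constructor
    · nlinarith [mul_le_mul_of_nonneg_left e1 hk.le]
    · nlinarith [mul_le_mul_of_nonneg_left e2 hk.le]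
  have hsum : ∀ z : Euc d, φ (x + z) - u x + (ψ (y + z) + v y) ≤
      (6 * s * k + 2) * min (2 * δ) ‖z‖ := by
    intro z
    rcases le_total (2 * δ) ‖z‖ with hz | hz
    · rw [min_eq_left hz]
      have h3 := hmax (x + z) (y + z)
      rw [add_sub_add_right_eq_sub] at h3
      have : 0 ≤ 6 * s * k * (2 * δ) := by positivity
      linarith [hφ2 z hz, hψ2 z hz]
    · rw [min_eq_right hz]
      obtain ⟨h1, h2⟩ := hnear z (hz.trans hδs)
      linarith [min_le_right δ ‖z‖]
  have hone : ∀ (t : ℝ) (z : Euc d), (‖z‖ ≤ s → t ≤ 3 * s * k * ‖z‖ + min δ ‖z‖) →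
      (s ≤ ‖z‖ → t ≤ 2 * Mb + δ) → t ≤ (3 * s * k + 2 * Mb / s + 1) * min s ‖z‖ := by
    intro t z h1 h2
    rcases le_total s ‖z‖ with hz | hz
    · rw [min_eq_left hz]
      have e1 : (3 * s * k + 2 * Mb / s + 1) * s = 3 * s * k * s + 2 * Mb + s := by
        field_simp
      have : 0 ≤ 3 * s * k * s := by positivity
      rw [e1]
      linarith [h2 hz]
    · rw [min_eq_right hz]
      have : 0 ≤ 2 * Mb / s * ‖z‖ := by positivity
      linarith [h1 hz, min_le_right δ ‖z‖]
  refine ⟨φ, fun y' => -ψ y', ⟨hφ, hφb, hφx, hφu⟩, ⟨hψ.neg, ?_, by simp [hψy],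
    fun y' => by linarith [hψv y']⟩, fun z => ?_, fun z => ?_, fun z => ?_⟩
  · obtain ⟨M, hM⟩ := hψb
    exact ⟨M, fun y' => by rw [abs_neg]; exact hM y'⟩
  · linarith [hsum z, hIφ z, hIψ z]
  · rw [hIφ]
    have h1 := hone (φ (x + z) - u x) z (fun hz => (hnear z hz).1) fun hz => by
      linarith [hφ2 z (hδs.trans hz), (abs_le.1 (huM (x + z))).2, (abs_le.1 (huM x)).1]
    linarith [neg_abs_le ((ball (0 : Euc d) 1).indicator (fun w => P w) z), hP1 z]
  · rw [hIψ]
    have h1 := hone (ψ (y + z) + v y) z (fun hz => (hnear z hz).2) fun hz => by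
      linarith [hψ2 z (hδs.trans hz), (abs_le.1 (hvM (y + z))).1, (abs_le.1 (hvM y)).2]
    linarith [le_abs_self ((ball (0 : Euc d) 1).indicator (fun w => P w) z), hP1 z]

theorem exists_max_doubling {O : Set (Euc d)} (hO : Bornology.IsBounded O) {u v : Euc d → ℝ}
    (hu : Continuous u) (hv : Continuous v) {Mb : ℝ} (huM : ∀ x, |u x| ≤ Mb)
    (hvM : ∀ x, |v x| ≤ Mb) (hout : ∀ x ∉ O, u x ≤ v x) {x₁ : Euc d} (hx₁ : x₁ ∈ O)
    {M δ k : ℝ} (hM0 : 0 < M) (hM : M = u x₁ - v x₁) (hδ : 0 < δ) (hδ1 : δ ≤ 1)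
    (hδu : ∀ a b, ‖a - b‖ < δ → |u a - u b| < M) (hδv : ∀ a b, ‖a - b‖ < δ → |v a - v b| < M)
    (hk : 0 < k) (hkδ : 4 * Mb < k * δ ^ 2) :
    ∃ x ∈ O, ∃ y ∈ O, M ≤ u x - v y ∧ ‖x - y‖ < δ ∧ k * ‖x - y‖ ^ 2 ≤ 2 * (u x - u y) ∧
      ∀ x' y', u x' - v y' - k * saturatedSq (x' - y') ≤ u x - v y - k * saturatedSq (x - y) := by
  set Φ : Euc d × Euc d → ℝ := fun p => u p.1 - v p.2 - k * saturatedSq (p.1 - p.2) with hΦ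
  have hsmall : ∀ p : Euc d × Euc d, M ≤ Φ p → saturatedSq (p.1 - p.2) ≤ 1 / 2 ∧
      ‖p.1 - p.2‖ < δ := by
    intro p hp
    have h1 : k * saturatedSq (p.1 - p.2) ≤ 2 * Mb := by
      simp only [hΦ] at hp
      linarith [(abs_le.1 (huM p.1)).2, (abs_le.1 (hvM p.2)).1]
    have h2 : saturatedSq (p.1 - p.2) < δ ^ 2 / 2 := by
      by_contra! h
      nlinarith [mul_le_mul_of_nonneg_left h hk.le]
    have h3 : saturatedSq (p.1 - p.2) ≤ 1 / 2 := by nlinarith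
    refine ⟨h3, lt_of_pow_lt_pow_left₀ 2 hδ.le ?_⟩
    linarith [sq_norm_le_of_saturatedSq_le le_rfl h3]
  have hin : ∀ p : Euc d × Euc d, M ≤ Φ p → p.1 ∈ O ∧ p.2 ∈ O := by
    intro p hp
    have h1 := (hsmall p hp).2
    have h2 : 0 ≤ k * saturatedSq (p.1 - p.2) := mul_nonneg hk.le (saturatedSq_nonneg _)
    simp only [hΦ] at hp
    constructor
    · by_contra h
      linarith [hout _ h, (abs_lt.1 (hδv _ _ h1)).2]
    · by_contra h
      linarith [hout _ h, (abs_lt.1 (hδu _ _ h1)).2]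
  have hΦc : Continuous Φ := by
    have := contDiff_saturatedSq (d := d).continuous
    fun_prop
  have hK : IsCompact (closure O ×ˢ closure O) := hO.isCompact_closure.prod hO.isCompact_closure
  obtain ⟨p, -, hp⟩ := hK.exists_isMaxOn
    ⟨(x₁, x₁), subset_closure hx₁, subset_closure hx₁⟩ hΦc.continuousOn
  have hMp : M ≤ Φ p := by
    have : Φ (x₁, x₁) ≤ Φ p := hp ⟨subset_closure hx₁, subset_closure hx₁⟩
    simp only [hΦ, sub_self, saturatedSq_zero, mul_zero, sub_zero] at this
    simp only [hΦ]
    linarith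
  have hmax : ∀ p', Φ p' ≤ Φ p := by
    intro p'
    rcases le_total M (Φ p') with h | h
    · exact hp ⟨subset_closure (hin p' h).1, subset_closure (hin p' h).2⟩
    · exact h.trans hMp
  obtain ⟨h1, h2⟩ := hsmall p hMp
  refine ⟨p.1, (hin p hMp).1, p.2, (hin p hMp).2, ?_, h2, ?_, fun x' y' => hmax (x', y')⟩
  · have : 0 ≤ k * saturatedSq (p.1 - p.2) := mul_nonneg hk.le (saturatedSq_nonneg _)
    simp only [hΦ] at hMp
    linarith
  · have h3 := hmax (p.2, p.2)
    simp only [hΦ, sub_self, saturatedSq_zero, mul_zero, sub_zero] at h3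
    nlinarith [sq_norm_le_of_saturatedSq_le le_rfl h1]

theorem LipschitzDominated.comparison [Nonempty A] [Nonempty B] {O : Set (Euc d)}
    (hO : Bornology.IsBounded O) {C : ℝ} (hC : 0 ≤ C) {ν : Measure (Euc d)}
    {μf : Euc d → A → B → Measure (Euc d)} (h : LipschitzDominated O C ν μf)
    (hν : Integrable (fun z : Euc d => min 1 ‖z‖) ν) {c f : A → B → Euc d → ℝ}
    (hf : AssumptionC O f) (hc : AssumptionD O c) {u v : Euc d → ℝ} (hu : IsBUC u)
    (hv : IsBUC v) (hsub : IsSubsolution O (Iop μf c f) u)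
    (hsuper : IsSupersolution O (Iop μf c f) v) (hout : ∀ x ∉ O, u x ≤ v x)
    {x₁ : Euc d} (hx₁ : x₁ ∈ O) : u x₁ ≤ v x₁ := by
  by_contra! hlt
  obtain ⟨⟨Mu, hMu⟩, hucu⟩ := hu
  obtain ⟨⟨Mv, hMv⟩, hucv⟩ := hv
  set Mb := max Mu Mv with hMbdef
  have huM : ∀ x, |u x| ≤ Mb := fun x => (hMu x).trans (le_max_left _ _)
  have hvM : ∀ x, |v x| ≤ Mb := fun x => (hMv x).trans (le_max_right _ _)
  have hMb : 0 ≤ Mb := (abs_nonneg _).trans (huM 0)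
  obtain ⟨θf, hθf, -, -, hθf', -⟩ := id hf
  obtain ⟨lam, lam1, hlam, -, hclam, θc, hθc, hθc'⟩ := id hc
  set M := u x₁ - v x₁ with hM
  have hM0 : 0 < M := sub_pos.2 hlt
  set J : ℝ → ℝ := fun s => ∫ z, min s ‖z‖ ∂ν with hJ
  set N := ∫ z, min 1 ‖z‖ ∂ν with hN
  have hN0 : 0 ≤ N := integral_nonneg fun z => le_min zero_le_one (norm_nonneg z)
  have hJ0 : Tendsto J (nhdsWithin 0 (Ioi 0)) (nhds 0) := tendsto_integral_min_norm hν
  set Q : ℝ := 4 + Mb + 2 * C * (4 + 2 * Mb + 3 * N) with hQ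
  have hQ0 : 0 < Q := by positivity
  obtain ⟨τ, hτ0, hτ1, hτQ⟩ : ∃ τ : ℝ, 0 < τ ∧ τ ≤ 1 ∧ τ * Q < lam * M := by
    refine ⟨min 1 (lam * M / (2 * Q)), by positivity, min_le_left _ _, ?_⟩
    calc min 1 (lam * M / (2 * Q)) * Q ≤ lam * M / (2 * Q) * Q := by
          gcongr; exact min_le_right _ _
      _ = lam * M / 2 := by field_simp
      _ < lam * M := by linarith [mul_pos hlam hM0]
  obtain ⟨δu, hδu0, hδu⟩ := Metric.uniformContinuous_iff.1 hucu (min M (τ / 2)) (by positivity)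
  obtain ⟨δv, hδv0, hδv⟩ := Metric.uniformContinuous_iff.1 hucv M hM0
  set r₀ := min 1 (min δu δv) with hr₀
  have hr₀0 : 0 < r₀ := by positivity
  have hur : ∀ a b, ‖a - b‖ < r₀ → |u a - u b| < min M (τ / 2) := fun a b hab => by
    rw [← Real.dist_eq]
    exact hδu (by rw [dist_eq_norm]; exact
      hab.trans_le ((min_le_right _ _).trans (min_le_left _ _)))
  have hvr : ∀ a b, ‖a - b‖ < r₀ → |v a - v b| < M := fun a b hab => by
    rw [← Real.dist_eq]
    exact hδv (by rw [dist_eq_norm]; exact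
      hab.trans_le ((min_le_right _ _).trans (min_le_right _ _)))
  have hsq : Tendsto (fun s : ℝ => 4 * Mb * s ^ 2) (nhdsWithin 0 (Ioi 0)) (nhds 0) := by
    have hc : Continuous fun s : ℝ => 4 * Mb * s ^ 2 := by fun_prop
    have := (hc.tendsto 0).mono_left (nhdsWithin_le_nhds (s := Ioi 0))
    simpa using this
  obtain ⟨s, ⟨hs0, hs1⟩, hJs, hfs, hcs, hMs⟩ :
      ∃ s, s ∈ Ioo (0 : ℝ) 1 ∧ J s < τ ∧ θf s < τ ∧ θc s < τ ∧ 4 * Mb * s ^ 2 < τ * r₀ ^ 2 :=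
    (Eventually.and (Ioo_mem_nhdsGT (zero_lt_one' ℝ)) ((hJ0.eventually_lt_const hτ0).and
      ((hθf.2.2.eventually_lt_const hτ0).and ((hθc.2.2.eventually_lt_const hτ0).and
        (hsq.eventually_lt_const (show 0 < τ * r₀ ^ 2 by positivity)))))).exists
  set k := τ / s ^ 2 with hk
  have hk0 : 0 < k := by positivity
  have hks : k * s ^ 2 = τ := by rw [hk]; field_simp
  have hkr : 4 * Mb < k * r₀ ^ 2 := by
    rw [hk, div_mul_eq_mul_div, lt_div_iff₀ (by positivity)]
    exact hMs
  obtain ⟨x, hx, y, hy, hMxy, hxyr, hkxy, hmax⟩ := exists_max_doubling hO hucu.continuous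
    hucv.continuous huM hvM hout hx₁ hM0 hM hr₀0 (min_le_left _ _)
    (fun a b hab => (hur a b hab).trans_le (min_le_left _ _)) hvr hk0 hkr
  have hxys : ‖x - y‖ ≤ s := by
    have h1 := ((le_abs_self _).trans_lt (hur x y hxyr)).trans_le (min_le_right _ _)
    have h2 : k * ‖x - y‖ ^ 2 ≤ k * s ^ 2 := by linarith
    exact le_of_pow_le_pow_left₀ two_ne_zero hs0.le (le_of_mul_le_mul_left h2 hk0)
  have hhalf : Tendsto (fun δ : ℝ => 2 * δ) (nhdsWithin 0 (Ioi 0)) (nhdsWithin 0 (Ioi 0)) := by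
    refine tendsto_nhdsWithin_iff.2 ⟨?_, ?_⟩
    · have hc : Continuous fun δ : ℝ => 2 * δ := by fun_prop
      have := (hc.tendsto 0).mono_left (nhdsWithin_le_nhds (s := Ioi 0))
      simpa using this
    · filter_upwards [self_mem_nhdsWithin] with δ hδ
      exact mul_pos two_pos (mem_Ioi.1 hδ)
  have hJδ : Tendsto (fun δ => (6 * s * k + 2) * J (2 * δ)) (nhdsWithin 0 (Ioi 0)) (nhds 0) := by
    simpa using (hJ0.comp hhalf).const_mul (6 * s * k + 2)
  obtain ⟨δ, ⟨hδ0, hδs⟩, hδτ⟩ : ∃ δ, δ ∈ Ioo (0 : ℝ) (s / 2) ∧ (6 * s * k + 2) * J (2 * δ) < τ :=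
    (Eventually.and (Ioo_mem_nhdsGT (half_pos hs0)) (hJδ.eventually_lt_const hτ0)).exists
  have hδs' : 2 * δ ≤ s := by linarith
  obtain ⟨φ, ψ, ⟨hφ, hφb, hφx, huφ⟩, ⟨hψ, hψb, hψy, hψv⟩, hdiff, hinc, hinc'⟩ :=
    exists_test_pair hucu.continuous hucv.continuous huM hvM hk0 hδ0 hδs' hxys hmax
  have hIu : Iop μf c f φ x ≤ 0 :=
    hsub φ hφ hφb x hx (fun z => by linarith [huφ z]) hφx
  have hIv : 0 ≤ Iop μf c f ψ y :=
    hsuper ψ hψ hψb y hy (fun z => by linarith [hψv z]) hψy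
  have hle : ∀ x ∈ O, ∀ (α : A) (β : B), μf x α β ≤ ν := fun x hx α β => h.le hx α β
  obtain ⟨α, hα⟩ := exists_forall_lt_of_iop_nonneg
    (exists_abs_isaacs_le hν hle hf hc hψ hψb hy) hIv hτ0
  obtain ⟨β, hβ⟩ := exists_lt_of_iop_nonpos
    (exists_abs_isaacs_le hν hle hf hc hφ hφb hx) hIu hτ0 α
  have hα := hα β
  obtain ⟨m, ρ, ρ', e, e', hμ, hμ', hρ, hρ'⟩ := h x hx y hy α β
  have hi2δ := integrable_min_norm_s1 hν (s := 2 * δ) (by linarith) (by linarith)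
  have his := integrable_min_norm_s1 hν hs0.le hs1.le
  have hL := integral_sub_integral_le_of_decomposition (by positivity) e e' hμ hμ' hρ hρ'
    (integrable_levyIncrement hν hφ hφb x) (integrable_levyIncrement hν hψ hψb y)
    (hi2δ.const_mul (6 * s * k + 2))
    ((his.const_mul (3 * s * k + 2 * Mb / s + 1)).add (hν.const_mul (3 * s * k)))
    (fun z => by positivity) (fun z => by simp only [Pi.add_apply]; positivity) hdiff hinc hinc'
  simp only [Pi.add_apply] at hL
  rw [integral_const_mul, integral_add (his.const_mul _) (hν.const_mul _), integral_const_mul,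
    integral_const_mul] at hL
  change Lop (μf x α β) φ x - Lop (μf y α β) ψ y ≤ (6 * s * k + 2) * J (2 * δ) +
    2 * (C * ‖x - y‖ * ((3 * s * k + 2 * Mb / s + 1) * J s + 3 * s * k * N)) at hL
  have hJs0 : 0 ≤ J s := integral_nonneg fun z => le_min hs0.le (norm_nonneg z)
  have hrest : C * ‖x - y‖ * ((3 * s * k + 2 * Mb / s + 1) * J s + 3 * s * k * N) ≤
      τ * (C * (4 + 2 * Mb + 3 * N)) := by
    calc _ ≤ C * s * ((3 * s * k + 2 * Mb / s + 1) * J s + 3 * s * k * N) := by gcongr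
      _ = C * ((3 * (k * s ^ 2) + 2 * Mb + s) * J s + 3 * (k * s ^ 2) * N) := by
          field_simp
      _ = C * ((3 * τ + 2 * Mb + s) * J s + 3 * τ * N) := by rw [hks]
      _ ≤ C * ((3 * 1 + 2 * Mb + 1) * τ + 3 * τ * N) := by gcongr
      _ = _ := by ring
  have hff : f α β y - f α β x ≤ τ := by
    have h1 := hθf' x hx y hy α β
    have h2 := hθf.2.1 hxys
    linarith [neg_abs_le (f α β x - f α β y)]
  have hcc : |(c α β x - c α β y) * v y| ≤ τ * Mb := by
    rw [abs_mul]
    have h1 := hθc' x hx y hy α β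
    have h2 := hθc.2.1 hxys
    exact mul_le_mul (by linarith) (hvM y) (abs_nonneg _) hτ0.le
  have hcM : lam * M ≤ c α β x * (u x - v y) :=
    mul_le_mul (hclam x hx α β).1 hMxy hM0.le (hlam.le.trans (hclam x hx α β).1)
  rw [hφx] at hβ
  rw [hψy] at hα
  have hfinal : lam * M < τ * Q := by
    rw [hQ]
    linarith [neg_abs_le ((c α β x - c α β y) * v y)]
  linarith

theorem exists_lipschitzDominated {O : Set (Euc d)} [Nontrivial (Euc d)] {σ : ℝ} (hσ0 : 0 < σ)
    (hσ1 : σ < 1) {Λ₁ : ℝ} (hΛ₁ : 0 < Λ₁) {C : ℝ} (hC0 : 0 ≤ C) {K : A → B → Euc d → Euc d → ℝ}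
    {μf : Euc d → A → B → Measure (Euc d)}
    (hμf : ∀ x ∈ O, ∀ (α : A) (β : B),
      μf x α β = volume.withDensity (fun z => ENNReal.ofReal (K α β x z)))
    (hKbound : ∀ x ∈ O, ∀ (α : A) (β : B), ∀ z : Euc d, z ≠ 0 →
      K α β x z ≤ Λ₁ * ‖z‖ ^ (-((d : ℝ) + σ)))
    (hKlip : ∀ x ∈ O, ∀ y ∈ O, ∀ (α : A) (β : B), ∀ z : Euc d, z ≠ 0 →
      |K α β x z - K α β y z| ≤ C * ‖x - y‖ * (Λ₁ * ‖z‖ ^ (-((d : ℝ) + σ)))) :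
    ∃ ν : Measure (Euc d), Integrable (fun z : Euc d => min 1 ‖z‖) ν ∧ ν {0} = 0 ∧
      LipschitzDominated O C ν μf := by
  refine ⟨_, integrable_min_norm_withDensity_rpow hσ0 hσ1 Λ₁ hΛ₁.le, ?_, ?_⟩
  · exact withDensity_absolutelyContinuous _ _ (measure_singleton 0)
  · intro x hx y hy α β
    have h0 : ∀ᵐ z ∂(volume : Measure (Euc d)), z ≠ 0 := by
      rw [ae_iff]
      simp
    have hdiff : ∀ x ∈ O, ∀ y ∈ O, ∀ᵐ z ∂(volume : Measure (Euc d)),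
        ENNReal.ofReal (K α β x z) ≤ ENNReal.ofReal (K α β y z) +
          ENNReal.ofReal (C * ‖x - y‖) * ENNReal.ofReal (Λ₁ * ‖z‖ ^ (-((d : ℝ) + σ))) := by
      intro x hx y hy
      filter_upwards [h0] with z hz
      rw [← ENNReal.ofReal_mul (by positivity)]
      refine (ENNReal.ofReal_le_ofReal ?_).trans ENNReal.ofReal_add_le
      linarith [le_abs_self (K α β x z - K α β y z), hKlip x hx y hy α β z hz]
    rw [hμf x hx, hμf y hy]
    refine exists_decomposition_withDensity (by fun_prop) ?_ ?_ (hdiff x hx y hy) ?_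
    · filter_upwards [h0] with z hz
      exact ENNReal.ofReal_le_ofReal (hKbound x hx α β z hz)
    · filter_upwards [h0] with z hz
      exact ENNReal.ofReal_le_ofReal (hKbound y hy α β z hz)
    · rw [norm_sub_rev x y]
      exact hdiff y hy x hx

theorem lipschitzDominated_top_of_subsingleton [Subsingleton (Euc d)] (O : Set (Euc d)) (C : ℝ)
    (μf : Euc d → A → B → Measure (Euc d)) : LipschitzDominated O C ⊤ μf := by
  intro x _ y _ α β
  obtain rfl := Subsingleton.elim x y
  exact ⟨μf x α β, 0, 0, by simp, by simp, le_top, le_top, Measure.zero_le _, Measure.zero_le _⟩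

/-- Corollary 4.9: for kernels `K_{αβ}(x,z)` of order `σ ∈ (0,1)` bounded by
`Λ₁|z|^{-(d+σ)}` and Lipschitz in `x`, Assumption B holds, Assumptions A and E hold with
`p = 1`, and the comparison principle holds for equation (E). -/
theorem comparison_order_less_than_one
    {d : ℕ} {A B : Type*} [Nonempty A] [Nonempty B]
    (O : Set (Euc d)) (hOopen : IsOpen O) (hObdd : Bornology.IsBounded O)
    (hOconn : IsConnected O)
    (σ : ℝ) (hσ0 : 0 < σ) (hσ1 : σ < 1)
    (Λ₁ : ℝ) (hΛ₁ : 0 < Λ₁) (C : ℝ) (hC0 : 0 ≤ C)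
    (K : A → B → Euc d → Euc d → ℝ)
    (μf : Euc d → A → B → Measure (Euc d))
    (hμf : ∀ x ∈ O, ∀ (α : A) (β : B),
      μf x α β = volume.withDensity (fun z => ENNReal.ofReal (K α β x z)))
    (hKpos : ∀ x ∈ O, ∀ (α : A) (β : B), ∀ z : Euc d, 0 ≤ K α β x z)
    (hKbound : ∀ x ∈ O, ∀ (α : A) (β : B), ∀ z : Euc d, z ≠ 0 →
      K α β x z ≤ Λ₁ * ‖z‖ ^ (-((d : ℝ) + σ)))
    (hKlip : ∀ x ∈ O, ∀ y ∈ O, ∀ (α : A) (β : B), ∀ z : Euc d, z ≠ 0 →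
      |K α β x z - K α β y z| ≤ C * ‖x - y‖ * (Λ₁ * ‖z‖ ^ (-((d : ℝ) + σ))))
    (c f : A → B → Euc d → ℝ)
    (hCas : AssumptionC O f) (hD : AssumptionD O c) :
    AssumptionB O (fun x α β => (μf x α β).restrict (ball (0 : Euc d) 1)ᶜ) ∧
    AssumptionA O 1 (fun x α β => (μf x α β).restrict (ball (0 : Euc d) 1)) ∧
    AssumptionE O 1 μf ∧
    (∀ u v : Euc d → ℝ, IsBUC u → IsBUC v →
      IsSubsolution O (Iop μf c f) u → IsSupersolution O (Iop μf c f) v →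
      (∀ x ∉ O, u x ≤ v x) → ∀ x ∈ O, u x ≤ v x) := by
  rcases subsingleton_or_nontrivial (Euc d) with hd | hd
  · have h := lipschitzDominated_top_of_subsingleton O C μf
    have hz : ∀ z : Euc d, ‖z‖ = 0 := fun z => by rw [Subsingleton.elim z 0, norm_zero]
    have hν : Integrable (fun z : Euc d => min 1 ‖z‖) (⊤ : Measure (Euc d)) := by
      simp [hz]
    exact ⟨h.assumptionB hC0 hν, assumptionA_of_subsingleton O _, h.assumptionE hν,
      fun u v hu hv hsub hsuper hout x hx =>
        h.comparison hObdd hC0 hν hCas hD hu hv hsub hsuper hout hx⟩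
  · obtain ⟨ν, hν, hν0, h⟩ := exists_lipschitzDominated hσ0 hσ1 hΛ₁ hC0 hμf hKbound hKlip
    exact ⟨h.assumptionB hC0 hν, h.assumptionA hC0 hν hν0, h.assumptionE hν,
      fun u v hu hv hsub hsuper hout x hx =>
        h.comparison hObdd hC0 hν hCas hD hu hv hsub hsuper hout hx⟩
end
end
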